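/- arXiv:1509.01844 — 2 statements merged into one kernel-verified Lean document; each statement's English description precedes it below -/
import Mathlib

section
/- There is a constant C > 0 such that for every weighted digraph G = (V, E, w) and every ε ∈ (0,1) there exists a reweighted subgraph G_ε of G with at most C·|V|/ε² edges which is simultaneously an ε-P-sparsifier of G for every predicate P ∈ {Cut, unCut, Or, nAnd, 10̄, 01̄, 1x, 0x, x1, x0, 1⃗, 0⃗} (the same subgraph G_ε works for all these predicates). -/
/-- A two-variable boolean predicate. -/
abbrev Pred := Bool → Bool → Bool

/-- The value `P_G(S)` of a predicate `P` on the weighted digraph `G = (V, E, w)`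
for a subset `S ⊆ V`. -/
def predVal {V : Type} [DecidableEq V] (P : Pred) (E : Finset (V × V))
    (w : V × V → ℝ) (S : Finset V) : ℝ :=
  ∑ e ∈ E, if P (decide (e.1 ∈ S)) (decide (e.2 ∈ S)) then w e else 0

/-- `(Eε, wε)` is an `ε`-`P`-sparsifier of `(E, w)`: a reweighted subgraph with strictly
positive weights whose `P`-value is within factor `(1 ± ε)` of that of `G` on every `S`. -/
def IsSparsifier {V : Type} [DecidableEq V] (P : Pred) (E : Finset (V × V))
    (w : V × V → ℝ) (Eε : Finset (V × V)) (wε : V × V → ℝ) (ε : ℝ) : Prop :=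
  Eε ⊆ E ∧ (∀ e ∈ Eε, 0 < wε e) ∧
    ∀ S : Finset V,
      (1 - ε) * predVal P E w S ≤ predVal P Eε wε S ∧
        predVal P Eε wε S ≤ (1 + ε) * predVal P E w S

/-- `Cut(x,y) = 1` iff `x ≠ y`. -/
def pCut : Pred := fun x y => x != y
/-- `unCut(x,y) = 1` iff `x = y`. -/
def pUnCut : Pred := fun x y => x == y
/-- `Or(x,y) = 1` iff `x = 1` or `y = 1`. -/
def pOr : Pred := fun x y => x || y
/-- `nAnd(x,y) = 1` iff not (`x = y = 1`). -/
def pNAnd : Pred := fun x y => !(x && y)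
/-- `10̄(x,y) = 0` iff `(x,y) = (1,0)`, otherwise `1`. -/
def pBar10 : Pred := fun x y => !(x && !y)
/-- `01̄(x,y) = 0` iff `(x,y) = (0,1)`, otherwise `1`. -/
def pBar01 : Pred := fun x y => !(!x && y)
/-- `1x(x,y) = x`. -/
def p1x : Pred := fun x _ => x
/-- `0x(x,y) = 1 − x`. -/
def p0x : Pred := fun x _ => !x
/-- `x1(x,y) = y`. -/
def px1 : Pred := fun _ y => y
/-- `x0(x,y) = 1 − y`. -/
def px0 : Pred := fun _ y => !y
/-- `1⃗(x,y) = 1`. -/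
def pOne : Pred := fun _ _ => true
/-- `0⃗(x,y) = 0`. -/
def pZero : Pred := fun _ _ => false

section BSS
open Matrix Finset

theorem bss_spec {n : Type*} [Fintype n] [DecidableEq n] (A : Matrix n n ℝ) (hA : A.IsHermitian) :
    ∃ lam : n → ℝ, ∀ a b : ℝ, ((a • (1 : Matrix n n ℝ) + b • A).PosDef ↔ ∀ i, 0 < a + b * lam i) ∧
      ((∀ i, 0 < a + b * lam i) →
        (a • (1 : Matrix n n ℝ) + b • A)⁻¹.trace = ∑ i, (a + b * lam i)⁻¹ ∧
        ((a • (1 : Matrix n n ℝ) + b • A)⁻¹ * (a • (1 : Matrix n n ℝ) + b • A)⁻¹).trace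
          = ∑ i, ((a + b * lam i)⁻¹)^2) := by
  set U : Matrix n n ℝ := hA.eigenvectorUnitary.1 with hU
  have h1 : U * star U = 1 := Unitary.coe_mul_star_self hA.eigenvectorUnitary
  have h2 : star U * U = 1 := Unitary.coe_star_mul_self hA.eigenvectorUnitary
  have hs : A = U * diagonal hA.eigenvalues * star U := by
    have := hA.spectral_theorem
    rw [Unitary.conjStarAlgAut_apply] at this
    simpa using this
  refine ⟨hA.eigenvalues, fun a b => ?_⟩
  have key : a • (1 : Matrix n n ℝ) + b • A
      = U * diagonal (fun i => a + b * hA.eigenvalues i) * star U := by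
    have : diagonal (fun i => a + b * hA.eigenvalues i)
        = a • (1 : Matrix n n ℝ) + b • diagonal hA.eigenvalues := by
      ext i j
      by_cases h : i = j
      · subst h; simp
      · simp [h]
    rw [this]
    conv_lhs => rw [hs]
    simp [mul_add, add_mul, h1]
  have hUu : IsUnit U := ⟨⟨U, star U, h1, h2⟩, rfl⟩
  refine ⟨?_, fun hpos => ?_⟩
  · rw [key, Matrix.IsUnit.posDef_star_right_conjugate_iff hUu, posDef_diagonal_iff]
  · have hinv : (a • (1 : Matrix n n ℝ) + b • A)⁻¹
      = U * diagonal (fun i => (a + b * hA.eigenvalues i)⁻¹) * star U := by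
      apply Matrix.inv_eq_right_inv
      rw [key]
      calc _ = U * (diagonal (fun i => a + b * hA.eigenvalues i) * (star U * U) *
              diagonal (fun i => (a + b * hA.eigenvalues i)⁻¹)) * star U := by
              simp only [mul_assoc]
        _ = 1 := by
              rw [h2, mul_one, diagonal_mul_diagonal]
              have : (fun i => (a + b * hA.eigenvalues i) * (a + b * hA.eigenvalues i)⁻¹)
                = fun _ => (1:ℝ) := by
                ext i; exact mul_inv_cancel₀ (hpos i).ne'
              rw [this, diagonal_one, mul_one, h1]
    have htr : ∀ M : Matrix n n ℝ, (U * M * star U).trace = M.trace := by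
      intro M
      rw [trace_mul_comm, ← mul_assoc, h2, one_mul]
    have hsq : U * diagonal (fun i => (a + b * hA.eigenvalues i)⁻¹) * star U *
       (U * diagonal (fun i => (a + b * hA.eigenvalues i)⁻¹) * star U)
       = U * diagonal (fun i => ((a + b * hA.eigenvalues i)⁻¹)^2) * star U := by
      calc _ = U * (diagonal (fun i => (a + b * hA.eigenvalues i)⁻¹) * (star U * U) *
              diagonal (fun i => (a + b * hA.eigenvalues i)⁻¹)) * star U := by
              simp only [mul_assoc]
        _ = _ := by rw [h2, mul_one, diagonal_mul_diagonal]; simp only [pow_two]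
    rw [hinv, hsq, htr, htr]
    simp [trace_diagonal]

theorem bss_rank_one {n : Type*} [Fintype n] [DecidableEq n] (B : Matrix n n ℝ) (hB : B.PosDef)
    (v : n → ℝ) (τ : ℝ) (h : 1 + τ * (v ⬝ᵥ (B⁻¹ *ᵥ v)) ≠ 0) :
    (B + τ • vecMulVec v v)⁻¹.trace = B⁻¹.trace -
      τ * ((B⁻¹ *ᵥ v) ⬝ᵥ (B⁻¹ *ᵥ v)) / (1 + τ * (v ⬝ᵥ (B⁻¹ *ᵥ v))) := by
  set R := B⁻¹ with hR
  have hBR : B * R = 1 := Matrix.mul_nonsing_inv _ ((Matrix.isUnit_iff_isUnit_det _).1 hB.isUnit)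
  have hRs : Rᵀ = R := by
    have := hB.inv.isHermitian.eq
    simpa [conjTranspose_eq_transpose_of_trivial] using this
  set c := τ / (1 + τ * (v ⬝ᵥ (R *ᵥ v))) with hc
  have hinv : (B + τ • vecMulVec v v)⁻¹ = R - c • vecMulVec (R *ᵥ v) (R *ᵥ v) := by
    apply Matrix.inv_eq_right_inv
    have e1 : B * vecMulVec (R *ᵥ v) (R *ᵥ v) = vecMulVec v (R *ᵥ v) := by
      rw [Matrix.mul_vecMulVec, mulVec_mulVec, hBR, one_mulVec]
    have e2 : vecMulVec v v * R = vecMulVec v (R *ᵥ v) := by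
      rw [Matrix.vecMulVec_mul, ← mulVec_transpose, hRs]
    have e3 : vecMulVec v v * vecMulVec (R *ᵥ v) (R *ᵥ v)
        = (v ⬝ᵥ (R *ᵥ v)) • vecMulVec v (R *ᵥ v) := by
      rw [Matrix.vecMulVec_mul_vecMulVec]; ext i j; simp [vecMulVec_apply]; ring
    rw [add_mul, mul_sub, mul_sub, hBR, mul_smul_comm, e1, smul_mul_assoc, e2, smul_mul_assoc,
      mul_smul_comm, e3]
    have : c * (1 + τ * (v ⬝ᵥ (R *ᵥ v))) = τ := by rw [hc]; field_simp
    ext i j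
    simp only [Matrix.add_apply, Matrix.sub_apply, Matrix.smul_apply, smul_eq_mul]
    linear_combination (-vecMulVec v (R *ᵥ v) i j) * this
  rw [hinv, trace_sub, trace_smul, trace_vecMulVec, smul_eq_mul, hc]
  ring

theorem bss_quad {n : Type*} [Fintype n] (B : Matrix n n ℝ) (τ : ℝ) (v x : n → ℝ) :
    x ⬝ᵥ ((B + τ • vecMulVec v v) *ᵥ x) = x ⬝ᵥ (B *ᵥ x) + τ * (v ⬝ᵥ x)^2 := by
  rw [add_mulVec, dotProduct_add, smul_mulVec, vecMulVec_mulVec, dotProduct_smul]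
  simp only [op_smul_eq_smul, dotProduct_smul, smul_eq_mul, dotProduct_comm x v]
  ring

theorem bss_herm {n : Type*} [Fintype n] (B : Matrix n n ℝ) (hB : B.IsHermitian) (τ : ℝ)
    (v : n → ℝ) : (B + τ • vecMulVec v v).IsHermitian := by
  have h := hB
  unfold Matrix.IsHermitian at *
  rw [conjTranspose_add, h]
  congr 1
  ext i j; simp [vecMulVec_apply, mul_comm]

theorem bss_posDef_up {n : Type*} [Fintype n] [DecidableEq n] (B : Matrix n n ℝ) (hB : B.PosDef)
    (v : n → ℝ) (t : ℝ) (ht : 0 ≤ t) : (B + t • vecMulVec v v).PosDef := by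
  rw [posDef_iff_dotProduct_mulVec]
  refine ⟨bss_herm _ hB.isHermitian _ _, fun x hx => ?_⟩
  have h0 := (posDef_iff_dotProduct_mulVec.1 hB).2 hx
  rw [star_trivial] at *
  rw [bss_quad]
  positivity

theorem bss_posDef_down {n : Type*} [Fintype n] [DecidableEq n] (B : Matrix n n ℝ) (hB : B.PosDef)
    (v : n → ℝ) (t : ℝ) (ht : 0 < t) (h : t * (v ⬝ᵥ (B⁻¹ *ᵥ v)) < 1) :
    (B + (-t) • vecMulVec v v).PosDef := by
  rw [posDef_iff_dotProduct_mulVec]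
  refine ⟨bss_herm _ hB.isHermitian _ _, fun x hx => ?_⟩
  have h0 := (posDef_iff_dotProduct_mulVec.1 hB).2 hx
  rw [star_trivial] at *
  rw [bss_quad]
  by_cases hvx : v ⬝ᵥ x = 0
  · rw [hvx]; simpa using h0
  have hBR : B * B⁻¹ = 1 := Matrix.mul_nonsing_inv _ ((Matrix.isUnit_iff_isUnit_det _).1 hB.isUnit)
  have hBs : Bᵀ = B := by
    have := hB.isHermitian.eq
    simpa [conjTranspose_eq_transpose_of_trivial] using this
  set s := t * (v ⬝ᵥ x)
  have h1 := hB.posSemidef.dotProduct_mulVec_nonneg (x - s • (B⁻¹ *ᵥ v))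
  have e1 : B *ᵥ (B⁻¹ *ᵥ v) = v := by rw [mulVec_mulVec, hBR, one_mulVec]
  have e2 : (B⁻¹ *ᵥ v) ⬝ᵥ (B *ᵥ x) = v ⬝ᵥ x := by
    rw [dotProduct_mulVec, ← mulVec_transpose, hBs, e1]
  rw [star_trivial, mulVec_sub, mulVec_smul, e1, sub_dotProduct, dotProduct_sub, dotProduct_sub,
    smul_dotProduct, smul_dotProduct, dotProduct_smul, dotProduct_smul, e2,
    dotProduct_comm (B⁻¹ *ᵥ v) v, dotProduct_comm x v] at h1
  simp only [smul_eq_mul] at h1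
  have h2 : 0 < t * (v ⬝ᵥ x)^2 * (1 - t * (v ⬝ᵥ (B⁻¹ *ᵥ v))) := by
    have : 0 < 1 - t * (v ⬝ᵥ (B⁻¹ *ᵥ v)) := by linarith
    positivity
  simp only [s] at h1
  nlinarith

theorem bss_sum_trace {ι n : Type*} [Fintype ι] [Fintype n] [DecidableEq n] (v : ι → n → ℝ)
    (hv : ∑ i, vecMulVec (v i) (v i) = 1) (R : Matrix n n ℝ) :
    ∑ i, v i ⬝ᵥ (R *ᵥ v i) = R.trace := by
  have : R.trace = (R * ∑ i, vecMulVec (v i) (v i)).trace := by rw [hv, mul_one]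
  rw [this, Finset.mul_sum, trace_sum]
  refine Finset.sum_congr rfl fun i _ => ?_
  rw [Matrix.mul_vecMulVec, trace_vecMulVec, dotProduct_comm]

theorem bss_sum_trace2 {ι n : Type*} [Fintype ι] [Fintype n] [DecidableEq n] (v : ι → n → ℝ)
    (hv : ∑ i, vecMulVec (v i) (v i) = 1) (R : Matrix n n ℝ) (hR : R.IsHermitian) :
    ∑ i, (R *ᵥ v i) ⬝ᵥ (R *ᵥ v i) = (R * R).trace := by
  have hRs : Rᵀ = R := by
    simpa [conjTranspose_eq_transpose_of_trivial] using hR.eq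
  rw [← bss_sum_trace v hv]
  refine Finset.sum_congr rfl fun i _ => ?_
  rw [← mulVec_mulVec, dotProduct_mulVec (v i), ← mulVec_transpose, hRs]

/-- lower scalar inequality -/
theorem bss_lower_scalar {n : Type*} [Fintype n] [Nonempty n] (a : n → ℝ) (ha : ∀ i, 0 < a i) (η : ℝ)
    (hη1 : η ≤ 1) (h : ∑ i, (a i + 1)⁻¹ ≤ η) :
    0 < ∑ i, (a i)⁻¹ - ∑ i, (a i + 1)⁻¹ ∧
    1 - η ≤ (∑ i, ((a i)⁻¹)^2) / (∑ i, (a i)⁻¹ - ∑ i, (a i + 1)⁻¹) - ∑ i, (a i)⁻¹ := by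
  set D := ∑ i, (a i)⁻¹ - ∑ i, (a i + 1)⁻¹ with hD
  have hDe : D = ∑ i, (a i)⁻¹ * (a i + 1)⁻¹ := by
    rw [hD, ← Finset.sum_sub_distrib]
    refine Finset.sum_congr rfl fun i _ => ?_
    have := ha i
    field_simp; ring
  have hDpos : 0 < D := by
    rw [hDe]
    exact Finset.sum_pos (fun i _ => by have := ha i; positivity) Finset.univ_nonempty
  refine ⟨hDpos, ?_⟩
  have hS : ∑ i, ((a i)⁻¹)^2 - D = ∑ i, ((a i)⁻¹)^2 * (a i + 1)⁻¹ := by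
    rw [hDe, ← Finset.sum_sub_distrib]
    refine Finset.sum_congr rfl fun i _ => ?_
    have := ha i
    field_simp; ring
  have hCS : D^2 ≤ (∑ i, (a i + 1)⁻¹) * ∑ i, ((a i)⁻¹)^2 * (a i + 1)⁻¹ := by
    rw [hDe]
    refine Finset.sum_sq_le_sum_mul_sum_of_sq_le_mul _ ?_ ?_ ?_
    · intro i _; have := ha i; positivity
    · intro i _; have := ha i; positivity
    · intro i _; exact le_of_eq (by ring)
  have hnn : 0 ≤ ∑ i, ((a i)⁻¹)^2 * (a i + 1)⁻¹ :=
    Finset.sum_nonneg fun i _ => by have := ha i; positivity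
  have h3 : D^2 ≤ ∑ i, ((a i)⁻¹)^2 - D := by
    rw [hS]; nlinarith
  have h4 : 1 + D ≤ (∑ i, ((a i)⁻¹)^2) / D := by
    rw [le_div_iff₀ hDpos]; nlinarith
  linarith

theorem bss_upper_scalar {n : Type*} [Fintype n] [Nonempty n] (a : n → ℝ) (δ : ℝ) (hδ : 0 < δ)
    (ha : ∀ i, 0 < a i) (η : ℝ) (h : ∑ i, (a i)⁻¹ ≤ η) :
    0 < ∑ i, (a i)⁻¹ - ∑ i, (a i + δ)⁻¹ ∧
    (∑ i, ((a i + δ)⁻¹)^2) / (∑ i, (a i)⁻¹ - ∑ i, (a i + δ)⁻¹) + ∑ i, (a i + δ)⁻¹ ≤ 1/δ + η := by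
  set D := ∑ i, (a i)⁻¹ - ∑ i, (a i + δ)⁻¹ with hD
  have hDe : D = ∑ i, δ * ((a i)⁻¹ * (a i + δ)⁻¹) := by
    rw [hD, ← Finset.sum_sub_distrib]
    refine Finset.sum_congr rfl fun i _ => ?_
    have := ha i
    field_simp; ring
  have hDpos : 0 < D := by
    rw [hDe]
    exact Finset.sum_pos (fun i _ => by have := ha i; positivity) Finset.univ_nonempty
  refine ⟨hDpos, ?_⟩
  have h1 : (∑ i, ((a i + δ)⁻¹)^2) / D ≤ 1 / δ := by
    rw [div_le_div_iff₀ hDpos hδ, one_mul, hDe, Finset.sum_mul]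
    refine Finset.sum_le_sum fun i _ => ?_
    have := ha i
    have h5 : (a i + δ)⁻¹ ≤ (a i)⁻¹ := inv_anti₀ this (by linarith)
    have h6 : 0 < (a i + δ)⁻¹ := by positivity
    have h7 : (a i + δ)⁻¹ * (a i + δ)⁻¹ ≤ (a i)⁻¹ * (a i + δ)⁻¹ := by gcongr
    nlinarith
  linarith

theorem bss_step {ι n : Type*} [Fintype ι] [Fintype n] [DecidableEq n] [Nonempty n] (v : ι → n → ℝ)
    (hv : ∑ i, vecMulVec (v i) (v i) = 1) (A : Matrix n n ℝ) (hA : A.IsHermitian)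
    (η u l : ℝ) (hη : 0 < η) (hη3 : η < 1 / 3)
    (hu : (u • (1 : Matrix n n ℝ) + (-1 : ℝ) • A).PosDef)
    (hl : ((-l) • (1 : Matrix n n ℝ) + (1 : ℝ) • A).PosDef)
    (hut : (u • (1 : Matrix n n ℝ) + (-1 : ℝ) • A)⁻¹.trace ≤ η)
    (hlt : ((-l) • (1 : Matrix n n ℝ) + (1 : ℝ) • A)⁻¹.trace ≤ η) :
    ∃ i : ι, ∃ t : ℝ, 0 < t ∧
      ((u + 1 / (1 - 3 * η)) • (1 : Matrix n n ℝ)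
        + (-1 : ℝ) • (A + t • vecMulVec (v i) (v i))).PosDef ∧
      ((-(l + 1)) • (1 : Matrix n n ℝ) + (1 : ℝ) • (A + t • vecMulVec (v i) (v i))).PosDef ∧
      ((u + 1 / (1 - 3 * η)) • (1 : Matrix n n ℝ)
        + (-1 : ℝ) • (A + t • vecMulVec (v i) (v i)))⁻¹.trace ≤ η ∧
      ((-(l + 1)) • (1 : Matrix n n ℝ)
        + (1 : ℝ) • (A + t • vecMulVec (v i) (v i)))⁻¹.trace ≤ η := by
  obtain ⟨lam, hlam⟩ := bss_spec A hA
  have h3 : 0 < 1 - 3 * η := by linarith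
  set δ := 1 / (1 - 3 * η) with hδ
  have hδpos : 0 < δ := by positivity
  have hδi : 1 / δ = 1 - 3 * η := by rw [hδ]; field_simp
  -- upper facts
  have hu1 := (hlam u (-1)).1.1 hu
  have hu2 := (hlam u (-1)).2 hu1
  have hu1' : ∀ i, 0 < (u + δ) + -1 * lam i := fun i => by have := hu1 i; linarith
  have hu3 := (hlam (u + δ) (-1)).1.2 hu1'
  have hu4 := (hlam (u + δ) (-1)).2 hu1'
  rw [hu2.1] at hut
  have hU := bss_upper_scalar (fun i => u + -1 * lam i) δ hδpos hu1 η hut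
  have eU : ∀ i, u + -1 * lam i + δ = (u + δ) + -1 * lam i := fun i => by ring
  simp only [eU] at hU
  rw [← hu4.1, ← hu4.2] at hU
  -- lower facts
  have hl1 := (hlam (-l) 1).1.1 hl
  have hl2 := (hlam (-l) 1).2 hl1
  rw [hl2.1] at hlt
  have hl1' : ∀ i, 0 < -(l + 1) + 1 * lam i := by
    intro i
    have h4 : (-l + 1 * lam i)⁻¹ ≤ η :=
      (Finset.single_le_sum (f := fun i => (-l + 1 * lam i)⁻¹)
        (fun j _ => (inv_pos.2 (hl1 j)).le) (Finset.mem_univ i)).trans hlt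
    have h5 : (-l + 1 * lam i)⁻¹ < 1 := by linarith
    have h6 := (inv_lt_one₀ (hl1 i)).1 h5
    linarith
  have hl3 := (hlam (-(l + 1)) 1).1.2 hl1'
  have hl4 := (hlam (-(l + 1)) 1).2 hl1'
  have eL : ∀ i, -(l + 1) + 1 * lam i + 1 = -l + 1 * lam i := fun i => by ring
  have hL := bss_lower_scalar (fun i => -(l + 1) + 1 * lam i) hl1' η (by linarith)
    (by simpa only [eL] using hlt)
  simp only [eL] at hL
  rw [← hl4.1, ← hl4.2] at hL
  set BU := (u + δ) • (1 : Matrix n n ℝ) + (-1 : ℝ) • A with hBU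
  set BL := (-(l + 1)) • (1 : Matrix n n ℝ) + (1 : ℝ) • A with hBL
  set DU := ∑ i, (u + -1 * lam i)⁻¹ - BU⁻¹.trace with hDU
  set DL := BL⁻¹.trace - ∑ i, (-l + 1 * lam i)⁻¹ with hDL
  have hsum : ∑ i, (((BU⁻¹ *ᵥ v i) ⬝ᵥ (BU⁻¹ *ᵥ v i)) / DU + v i ⬝ᵥ (BU⁻¹ *ᵥ v i)) <
      ∑ i, (((BL⁻¹ *ᵥ v i) ⬝ᵥ (BL⁻¹ *ᵥ v i)) / DL - v i ⬝ᵥ (BL⁻¹ *ᵥ v i)) := by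
    rw [Finset.sum_add_distrib, Finset.sum_sub_distrib, ← Finset.sum_div, ← Finset.sum_div,
      bss_sum_trace v hv, bss_sum_trace v hv, bss_sum_trace2 v hv _ hu3.inv.isHermitian,
      bss_sum_trace2 v hv _ hl3.inv.isHermitian]
    linarith [hU.2, hL.2]
  obtain ⟨i, -, hi⟩ := Finset.exists_lt_of_sum_lt hsum
  have hqU : 0 ≤ ((BU⁻¹ *ᵥ v i) ⬝ᵥ (BU⁻¹ *ᵥ v i)) := by
    have := dotProduct_star_self_nonneg (BU⁻¹ *ᵥ v i); simpa using this
  have hpU : 0 ≤ v i ⬝ᵥ (BU⁻¹ *ᵥ v i) := by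
    simpa using hu3.inv.posSemidef.dotProduct_mulVec_nonneg (v i)
  have hpL : 0 ≤ v i ⬝ᵥ (BL⁻¹ *ᵥ v i) := by
    simpa using hl3.inv.posSemidef.dotProduct_mulVec_nonneg (v i)
  set qU := ((BU⁻¹ *ᵥ v i) ⬝ᵥ (BU⁻¹ *ᵥ v i))
  set pU := v i ⬝ᵥ (BU⁻¹ *ᵥ v i)
  set qL := ((BL⁻¹ *ᵥ v i) ⬝ᵥ (BL⁻¹ *ᵥ v i))
  set pL := v i ⬝ᵥ (BL⁻¹ *ᵥ v i)
  have hDUp : 0 < DU := hU.1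
  have hDLp : 0 < DL := hL.1
  have hq1 : 0 ≤ qU / DU := by positivity
  have hLpos : 0 < qL / DL - pL := by linarith
  set t := 1 / (qL / DL - pL) with ht
  have htpos : 0 < t := by positivity
  have htL : t * (qL / DL - pL) = 1 := by rw [ht]; exact one_div_mul_cancel hLpos.ne'
  have htU : t * (qU / DU + pU) < 1 := by
    rw [← htL]; exact mul_lt_mul_of_pos_left hi htpos
  have htp : t * pU < 1 := by nlinarith [mul_nonneg htpos.le hq1]
  have e1 : (u + δ) • (1 : Matrix n n ℝ) + (-1 : ℝ) • (A + t • vecMulVec (v i) (v i))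
      = BU + (-t) • vecMulVec (v i) (v i) := by rw [hBU]; module
  have e2 : (-(l + 1)) • (1 : Matrix n n ℝ) + (1 : ℝ) • (A + t • vecMulVec (v i) (v i))
      = BL + t • vecMulVec (v i) (v i) := by rw [hBL]; module
  refine ⟨i, t, htpos, ?_, ?_, ?_, ?_⟩
  · rw [e1]; exact bss_posDef_down _ hu3 _ _ htpos htp
  · rw [e2]; exact bss_posDef_up _ hl3 _ _ htpos.le
  · rw [e1, bss_rank_one _ hu3 _ _ (by change 1 + -t * pU ≠ 0; nlinarith)]
    change BU⁻¹.trace - -t * qU / (1 + -t * pU) ≤ η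
    have h7 : t * qU / (1 - t * pU) ≤ DU := by
      rw [div_le_iff₀ (by linarith)]
      have : t * qU = DU * (t * (qU / DU)) := by field_simp
      rw [this]
      apply mul_le_mul_of_nonneg_left _ hDUp.le
      linarith
    have h8 : -t * qU / (1 + -t * pU) = - (t * qU / (1 - t * pU)) := by
      rw [neg_mul, neg_mul, neg_div, ← sub_eq_add_neg]
    rw [h8]
    linarith
  · have hden : 0 < 1 + t * pL := by positivity
    rw [e2, bss_rank_one _ hl3 _ _ hden.ne']
    change BL⁻¹.trace - t * qL / (1 + t * pL) ≤ η
    have h7 : t * qL / (1 + t * pL) = DL := by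
      rw [div_eq_iff hden.ne']
      have : t * qL = DL * (t * (qL / DL)) := by field_simp
      rw [this]
      congr 1
      linarith
    rw [h7]
    linarith

theorem bss_iter {ι n : Type*} [Fintype ι] [DecidableEq ι] [Fintype n] [DecidableEq n] [Nonempty n]
    (v : ι → n → ℝ) (hv : ∑ i, vecMulVec (v i) (v i) = 1)
    (η : ℝ) (hη : 0 < η) (hη3 : η < 1 / 3) (T : ℕ) :
    ∃ s : ι → ℝ, (∀ i, 0 ≤ s i) ∧ (Finset.univ.filter (fun i => s i ≠ 0)).card ≤ T ∧
    ((Fintype.card n / η + T * (1 / (1 - 3 * η))) • (1 : Matrix n n ℝ)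
        + (-1 : ℝ) • ∑ i, s i • vecMulVec (v i) (v i)).PosDef ∧
    ((-(-(Fintype.card n / η) + T)) • (1 : Matrix n n ℝ)
        + (1 : ℝ) • ∑ i, s i • vecMulVec (v i) (v i)).PosDef ∧
    ((Fintype.card n / η + T * (1 / (1 - 3 * η))) • (1 : Matrix n n ℝ)
        + (-1 : ℝ) • ∑ i, s i • vecMulVec (v i) (v i))⁻¹.trace ≤ η ∧
    ((-(-(Fintype.card n / η) + T)) • (1 : Matrix n n ℝ)
        + (1 : ℝ) • ∑ i, s i • vecMulVec (v i) (v i))⁻¹.trace ≤ η := by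
  have hn : (0 : ℝ) < Fintype.card n := by exact_mod_cast Fintype.card_pos
  induction T with
  | zero =>
    refine ⟨fun _ => 0, fun _ => le_rfl, by simp, ?_⟩
    have hpd : (((Fintype.card n : ℝ) / η) • (1 : Matrix n n ℝ)).PosDef :=
      Matrix.PosDef.one.smul (by positivity)
    have hinv : (((Fintype.card n : ℝ) / η) • (1 : Matrix n n ℝ))⁻¹
        = (η / (Fintype.card n : ℝ)) • (1 : Matrix n n ℝ) := by
      apply Matrix.inv_eq_right_inv
      rw [smul_mul_smul_comm, one_mul]
      have : ((Fintype.card n : ℝ) / η) * (η / (Fintype.card n : ℝ)) = 1 := by field_simp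
      rw [this, one_smul]
    have htr : (((Fintype.card n : ℝ) / η) • (1 : Matrix n n ℝ))⁻¹.trace ≤ η := by
      rw [hinv, trace_smul, trace_one, smul_eq_mul, div_mul_cancel₀ _ hn.ne']
    simp only [Nat.cast_zero, zero_mul, add_zero, neg_neg, zero_smul, Finset.sum_const_zero,
      smul_zero]
    exact ⟨hpd, hpd, htr, htr⟩
  | succ T ih =>
    obtain ⟨s, hs0, hsc, h1, h2, h3, h4⟩ := ih
    have hA : (∑ i, s i • vecMulVec (v i) (v i)).IsHermitian := by
      have : ∀ S : Finset ι, (∑ i ∈ S, s i • vecMulVec (v i) (v i)).IsHermitian := by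
        intro S
        induction S using Finset.induction_on with
        | empty => simp
        | insert a S ha ih => rw [Finset.sum_insert ha, add_comm]; exact bss_herm _ ih _ _
      exact this _
    obtain ⟨i, t, ht, g1, g2, g3, g4⟩ := bss_step v hv _ hA η _ _ hη hη3 h1 h2 h3 h4
    have hsum : ∑ j, (s + (Pi.single i t : ι → ℝ)) j • vecMulVec (v j) (v j)
        = ∑ j, s j • vecMulVec (v j) (v j) + t • vecMulVec (v i) (v i) := by
      simp only [Pi.add_apply, add_smul, Finset.sum_add_distrib]
      congr 1
      rw [Finset.sum_eq_single i]
      · simp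
      · intro j _ hj; simp [hj]
      · simp
    have eu : (Fintype.card n / η + ((T + 1 : ℕ) : ℝ) * (1 / (1 - 3 * η)))
      = (Fintype.card n / η + T * (1 / (1 - 3 * η))) + 1 / (1 - 3 * η) := by push_cast; ring
    have el : (-(-(Fintype.card n / η) + ((T + 1 : ℕ) : ℝ)))
      = -((-(Fintype.card n / η) + T) + 1) := by push_cast; ring
    refine ⟨s + Pi.single i t, ?_, ?_, ?_⟩
    · intro j
      by_cases hj : j = i
      · subst hj; simp; linarith [hs0 j]
      · simp [hj, hs0 j]
    · calc _ ≤ (insert i (Finset.univ.filter (fun i => s i ≠ 0))).card := by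
            apply Finset.card_le_card
            intro j hj
            by_cases hji : j = i
            · simp [hji]
            · simpa [hji] using hj
        _ ≤ _ := (Finset.card_insert_le _ _).trans (by omega)
    · rw [hsum, eu, el]
      exact ⟨g1, g2, g3, g4⟩

theorem bss_quad_sum {ι n : Type*} [Fintype ι] [Fintype n] [DecidableEq n]
    (v : ι → n → ℝ) (s : ι → ℝ) (a b : ℝ) (x : n → ℝ) :
    x ⬝ᵥ ((a • (1 : Matrix n n ℝ) + b • ∑ i, s i • vecMulVec (v i) (v i)) *ᵥ x)
      = a * (x ⬝ᵥ x) + b * ∑ i, s i * (v i ⬝ᵥ x)^2 := by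
  rw [add_mulVec, dotProduct_add, smul_mulVec, smul_mulVec, one_mulVec, dotProduct_smul,
    dotProduct_smul, Matrix.sum_mulVec, dotProduct_sum, smul_eq_mul, smul_eq_mul]
  congr 2
  refine Finset.sum_congr rfl fun i _ => ?_
  have := bss_quad (0 : Matrix n n ℝ) (s i) (v i) x
  simpa using this

/-- Batson-Spielman-Srivastava, isotropic form. -/
theorem bss_main {ι n : Type*} [Fintype ι] [DecidableEq ι] [Fintype n] [DecidableEq n]
    (v : ι → n → ℝ) (hv : ∑ i, vecMulVec (v i) (v i) = 1)
    (ε : ℝ) (hε : 0 < ε) (hε1 : ε < 1) :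
    ∃ s : ι → ℝ, (∀ i, 0 ≤ s i) ∧
      ((Finset.univ.filter (fun i => s i ≠ 0)).card : ℝ) ≤ 200 * Fintype.card n / ε ^ 2 ∧
      ∀ x : n → ℝ, (1 - ε) * (x ⬝ᵥ x) ≤ ∑ i, s i * (v i ⬝ᵥ x)^2 ∧
        ∑ i, s i * (v i ⬝ᵥ x)^2 ≤ (1 + ε) * (x ⬝ᵥ x) := by
  rcases isEmpty_or_nonempty n with hn | hn
  · refine ⟨fun _ => 0, fun _ => le_rfl, by simp, fun x => by simp [dotProduct]⟩
  have hN : (1 : ℝ) ≤ Fintype.card n := by exact_mod_cast Fintype.card_pos (α := n)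
  set N : ℝ := (Fintype.card n : ℝ) with hNdef
  set η := ε / 10 with hη
  have hηpos : 0 < η := by positivity
  have hη1 : η < 1 / 10 := by rw [hη]; linarith
  set T := ⌈N / η ^ 2⌉₊ with hT
  have hT1 : N / η ^ 2 ≤ T := Nat.le_ceil _
  have hT2 : (T : ℝ) < N / η ^ 2 + 1 := Nat.ceil_lt_add_one (by positivity)
  have hTpos : (0 : ℝ) < T := lt_of_lt_of_le (by positivity) hT1
  obtain ⟨s, hs0, hsc, h1, h2, -, -⟩ := bss_iter v hv η hηpos (by linarith) T
  have hNη : N / η ≤ η * T := by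
    have : N / η = η * (N / η ^ 2) := by field_simp
    rw [this]; gcongr
  have hinv : 1 / (1 - 3 * η) ≤ 1 + 6 * η := by
    rw [div_le_iff₀ (by linarith)]; nlinarith
  refine ⟨fun i => s i / T, fun i => div_nonneg (hs0 i) hTpos.le, ?_, ?_⟩
  · have e : (Finset.univ.filter (fun i => s i / (T : ℝ) ≠ 0))
        = Finset.univ.filter (fun i => s i ≠ 0) := by
      ext i; simp [hTpos.ne']
    rw [e]
    have hsc' : ((Finset.univ.filter (fun i => s i ≠ 0)).card : ℝ) ≤ T := by exact_mod_cast hsc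
    have h6 : N / η ^ 2 = 100 * N / ε ^ 2 := by rw [hη]; field_simp; norm_num
    have h7 : 1 ≤ 100 * N / ε ^ 2 := by
      rw [le_div_iff₀ (by positivity)]; nlinarith
    have h8 : 200 * N / ε ^ 2 = 100 * N / ε ^ 2 + 100 * N / ε ^ 2 := by ring
    linarith
  · intro x
    have hxx : 0 ≤ x ⬝ᵥ x := by simpa using dotProduct_star_self_nonneg x
    have e : ∑ i, s i / T * (v i ⬝ᵥ x)^2 = (∑ i, s i * (v i ⬝ᵥ x)^2) / T := by
      rw [Finset.sum_div]; exact Finset.sum_congr rfl fun i _ => by ring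
    rw [e]
    have k1 := h1.posSemidef.dotProduct_mulVec_nonneg x
    have k2 := h2.posSemidef.dotProduct_mulVec_nonneg x
    rw [star_trivial, bss_quad_sum] at k1 k2
    rw [le_div_iff₀ hTpos, div_le_iff₀ hTpos]
    constructor
    · have : (1 - ε) * T ≤ -(N / η) + T := by
        have : η * T ≤ ε * T := by gcongr; linarith
        linarith
      nlinarith [mul_le_mul_of_nonneg_right this hxx]
    · have : N / η + T * (1 / (1 - 3 * η)) ≤ (1 + ε) * T := by
        have h9 : (T : ℝ) * (1 / (1 - 3 * η)) ≤ T * (1 + 6 * η) := by gcongr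
        have h10 : ε = 10 * η := by rw [hη]; ring
        rw [h10]
        nlinarith
      nlinarith [mul_le_mul_of_nonneg_right this hxx]

theorem subspace_sparsify {ι : Type*} [Fintype ι] [DecidableEq ι]
    (W : Submodule ℝ (EuclideanSpace ℝ ι)) (ε : ℝ) (hε : 0 < ε) (hε1 : ε < 1) :
    ∃ s : ι → ℝ, (∀ i, 0 ≤ s i) ∧
      ((Finset.univ.filter (fun i => s i ≠ 0)).card : ℝ) ≤ 200 * Module.finrank ℝ W / ε ^ 2 ∧
      ∀ f ∈ W, (1 - ε) * ∑ e, (f e)^2 ≤ ∑ e, s e * (f e)^2 ∧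
        ∑ e, s e * (f e)^2 ≤ (1 + ε) * ∑ e, (f e)^2 := by
  let b := stdOrthonormalBasis ℝ W
  obtain ⟨v, hvdef⟩ : ∃ v : ι → Fin (Module.finrank ℝ W) → ℝ,
    ∀ e j, v e j = (b j : EuclideanSpace ℝ ι) e := ⟨_, fun _ _ => rfl⟩
  have hv : ∑ i, vecMulVec (v i) (v i) = 1 := by
    ext j k
    have := orthonormal_iff_ite.1 b.orthonormal j k
    rw [Submodule.coe_inner, PiLp.inner_apply] at this
    simp only [Matrix.sum_apply, vecMulVec_apply, Matrix.one_apply]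
    rw [← this]
    refine Finset.sum_congr rfl fun e _ => ?_
    rw [hvdef, hvdef, mul_comm]; rfl
  obtain ⟨s, hs0, hsc, hs⟩ := bss_main v hv ε hε hε1
  rw [Fintype.card_fin] at hsc
  refine ⟨s, hs0, hsc, fun f hf => ?_⟩
  obtain ⟨c, hc⟩ : ∃ c : Fin (Module.finrank ℝ W) → ℝ, ∀ j, c j = b.repr ⟨f, hf⟩ j :=
    ⟨_, fun _ => rfl⟩
  have h1 : ∀ e, v e ⬝ᵥ c = f e := by
    intro e
    have h2 : f = ∑ j, c j • (b j : EuclideanSpace ℝ ι) := by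
      have := congrArg (Subtype.val) (b.sum_repr ⟨f, hf⟩)
      rw [Submodule.coe_sum] at this
      simp only [hc]
      exact this.symm
    have h3 : f e = ∑ j, c j * (b j : EuclideanSpace ℝ ι) e := by
      conv_lhs => rw [h2]
      rw [WithLp.ofLp_sum, Finset.sum_apply]
      rfl
    rw [h3]
    simp only [dotProduct, hvdef]
    exact Finset.sum_congr rfl fun j _ => mul_comm _ _
  have h4 : c ⬝ᵥ c = ∑ e, (f e)^2 := by
    simp only [← h1]
    have := bss_quad_sum v (fun _ => 1) 0 1 c
    simp only [one_smul, hv, zero_smul, zero_add, one_mulVec, zero_mul, one_mul] at this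
    exact this
  have := hs c
  simp only [h1, h4] at this
  exact this

theorem cut_sparsify (V : Type) [Fintype V] [DecidableEq V]
    (E : Finset (V × V)) (w : V × V → ℝ) (hw : ∀ e ∈ E, 0 < w e) (ε : ℝ) (hε : 0 < ε)
    (hε1 : ε < 1) :
    ∃ s : E → ℝ, (∀ i, 0 ≤ s i) ∧
      ((Finset.univ.filter (fun i => s i ≠ 0)).card : ℝ) ≤ 400 * Fintype.card V / ε ^ 2 ∧
      ∀ x y : V → ℝ,
        (1 - ε) * ∑ e : E, w e * (x e.1.1 - y e.1.2)^2
          ≤ ∑ e : E, s e * (w e * (x e.1.1 - y e.1.2)^2) ∧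
        ∑ e : E, s e * (w e * (x e.1.1 - y e.1.2)^2)
          ≤ (1 + ε) * ∑ e : E, w e * (x e.1.1 - y e.1.2)^2 := by
  let F : ((V → ℝ) × (V → ℝ)) →ₗ[ℝ] EuclideanSpace ℝ E :=
    { toFun := fun z => WithLp.toLp 2 (fun e : E => √(w e) * (z.1 e.1.1 - z.2 e.1.2))
      map_add' := by
        intro z z'
        ext e
        simp
        ring
      map_smul' := by
        intro c z
        ext e
        simp
        ring }
  have hk : Module.finrank ℝ (LinearMap.range F) ≤ 2 * Fintype.card V := by
    have := LinearMap.finrank_range_le F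
    simpa [two_mul] using this
  obtain ⟨s, hs0, hsc, hs⟩ := subspace_sparsify (LinearMap.range F) ε hε hε1
  refine ⟨s, hs0, hsc.trans ?_, ?_⟩
  · have : (Module.finrank ℝ (LinearMap.range F) : ℝ) ≤ 2 * Fintype.card V := by
      exact_mod_cast hk
    apply div_le_div_of_nonneg_right _ (by positivity)
    linarith
  · intro x y
    have h3 : ∀ e : E, (F (x, y) e)^2 = w e * (x e.1.1 - y e.1.2)^2 := by
      intro e
      have h2 : F (x, y) e = √(w e) * (x e.1.1 - y e.1.2) := rfl
      rw [h2, mul_pow, Real.sq_sqrt (hw e e.2).le]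
    have := hs (F (x, y)) (LinearMap.mem_range_self _ _)
    simp only [h3] at this
    exact this

theorem stmt5_aux (V : Type) [Fintype V] [DecidableEq V]
    (E : Finset (V × V)) (w : V × V → ℝ) (hw : ∀ e ∈ E, 0 < w e) (ε : ℝ) (hε : 0 < ε)
    (hε1 : ε < 1) :
    ∃ (Eε : Finset (V × V)) (wε : V × V → ℝ),
      (Eε.card : ℝ) ≤ 400 * (Fintype.card V) / ε ^ 2 ∧ Eε ⊆ E ∧ (∀ e ∈ Eε, 0 < wε e) ∧
      ∀ x y : V → ℝ,
        (1 - ε) * ∑ e ∈ E, w e * (x e.1 - y e.2)^2 ≤ ∑ e ∈ Eε, wε e * (x e.1 - y e.2)^2 ∧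
        ∑ e ∈ Eε, wε e * (x e.1 - y e.2)^2 ≤ (1 + ε) * ∑ e ∈ E, w e * (x e.1 - y e.2)^2 := by
  obtain ⟨s, hs0, hsc, hs⟩ := cut_sparsify V E w hw ε hε hε1
  refine ⟨(Finset.univ.filter (fun i => s i ≠ 0)).map (Function.Embedding.subtype _),
    fun e => if h : e ∈ E then s ⟨e, h⟩ * w e else 0, ?_, ?_, ?_, ?_⟩
  · rwa [Finset.card_map]
  · intro e he
    simp only [Finset.mem_map] at he
    obtain ⟨a, -, rfl⟩ := he
    exact a.2
  · intro e he
    simp only [Finset.mem_map, Finset.mem_filter] at he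
    obtain ⟨a, ⟨-, ha⟩, rfl⟩ := he
    have h1 : ((Function.Embedding.subtype fun x => x ∈ E) a) ∈ E := a.2
    beta_reduce
    rw [dif_pos h1]
    exact mul_pos (lt_of_le_of_ne (hs0 a) (Ne.symm ha)) (hw _ a.2)
  · intro x y
    have e1 : ∑ e ∈ E, w e * (x e.1 - y e.2)^2 = ∑ e : E, w e * (x e.1.1 - y e.1.2)^2 :=
      (Finset.sum_coe_sort E (fun e => w e * (x e.1 - y e.2)^2)).symm
    rw [e1, Finset.sum_map, Finset.sum_filter]
    have e2 : ∀ a : E, (if s a ≠ 0 then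
        (if h : (Function.Embedding.subtype fun x => x ∈ E) a ∈ E
          then s ⟨(Function.Embedding.subtype fun x => x ∈ E) a, h⟩ *
            w ((Function.Embedding.subtype fun x => x ∈ E) a) else 0) *
        (x ((Function.Embedding.subtype fun x => x ∈ E) a).1 -
          y ((Function.Embedding.subtype fun x => x ∈ E) a).2)^2 else 0)
        = s a * (w a * (x a.1.1 - y a.1.2)^2) := by
      intro a
      have h1 : ((Function.Embedding.subtype fun x => x ∈ E) a) ∈ E := a.2
      rw [dif_pos h1]
      by_cases h : s a = 0
      · simp [h]
      · rw [if_pos h]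
        simp [mul_assoc]
    simp only [e2]
    exact hs x y

theorem predVal_eq {V : Type} [DecidableEq V] (P : Pred) (E : Finset (V × V))
    (w : V × V → ℝ) (S : Finset V) (p : V × V → ℝ)
    (hp : ∀ e, p e = if P (decide (e.1 ∈ S)) (decide (e.2 ∈ S)) then 1 else 0) :
    predVal P E w S = ∑ e ∈ E, w e * p e := by
  unfold predVal
  refine Finset.sum_congr rfl fun e _ => ?_
  rw [hp]; split_ifs <;> simp

end BSS

/-- There is a constant `C > 0` such that every weighted digraph
`G = (V, E, w)` with strictly positive weights and every `ε ∈ (0,1)` admit a single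
reweighted subgraph with at most `C·|V|/ε²` edges which is simultaneously an
`ε`-`P`-sparsifier of `G` for every
`P ∈ {Cut, unCut, Or, nAnd, 10̄, 01̄, 1x, 0x, x1, x0, 1⃗, 0⃗}`. -/
theorem stmt5 :
    ∃ C : ℝ, 0 < C ∧
      ∀ (V : Type) [Fintype V] [DecidableEq V]
        (E : Finset (V × V)) (w : V × V → ℝ), (∀ e ∈ E, 0 < w e) →
        ∀ ε : ℝ, ε ∈ Set.Ioo (0 : ℝ) 1 →
          ∃ (Eε : Finset (V × V)) (wε : V × V → ℝ),
            (Eε.card : ℝ) ≤ C * (Fintype.card V) / ε ^ 2 ∧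
            ∀ P ∈ [pCut, pUnCut, pOr, pNAnd, pBar10, pBar01,
                    p1x, p0x, px1, px0, pOne, pZero],
              IsSparsifier P E w Eε wε ε := by
  refine ⟨400, by norm_num, ?_⟩
  intro V _ _ E w hw ε hε
  obtain ⟨Eε, wε, hcard, hsub, hpos, H⟩ := stmt5_aux V E w hw ε hε.1 hε.2
  refine ⟨Eε, wε, hcard, ?_⟩
  -- three squares with total twice the predicate suffice
  have key : ∀ P : Pred, (∀ S : Finset V, ∃ x₁ y₁ x₂ y₂ x₃ y₃ : V → ℝ, ∀ e : V × V,
      (x₁ e.1 - y₁ e.2)^2 + (x₂ e.1 - y₂ e.2)^2 + (x₃ e.1 - y₃ e.2)^2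
        = 2 * if P (decide (e.1 ∈ S)) (decide (e.2 ∈ S)) then 1 else 0) →
      IsSparsifier P E w Eε wε ε := by
    intro P hP
    refine ⟨hsub, hpos, fun S => ?_⟩
    obtain ⟨x₁, y₁, x₂, y₂, x₃, y₃, h⟩ := hP S
    have hsum : ∀ (D : Finset (V × V)) (c : V × V → ℝ), predVal P D c S =
        (∑ e ∈ D, c e * (x₁ e.1 - y₁ e.2)^2 + ∑ e ∈ D, c e * (x₂ e.1 - y₂ e.2)^2
          + ∑ e ∈ D, c e * (x₃ e.1 - y₃ e.2)^2) / 2 := by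
      intro D c
      rw [predVal_eq P D c S (fun e => ((x₁ e.1 - y₁ e.2)^2 + (x₂ e.1 - y₂ e.2)^2
        + (x₃ e.1 - y₃ e.2)^2) / 2) (fun e => by rw [h e]; ring), ← Finset.sum_add_distrib,
        ← Finset.sum_add_distrib, Finset.sum_div]
      exact Finset.sum_congr rfl fun e _ => by ring
    rw [hsum, hsum]
    have h1 := H x₁ y₁
    have h2 := H x₂ y₂
    have h3 := H x₃ y₃
    constructor
    · linarith [h1.1, h2.1, h3.1]
    · linarith [h1.2, h2.2, h3.2]
  -- indicator and its complement
  let ind : Finset V → V → ℝ := fun S u => if u ∈ S then 1 else 0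
  let cind : Finset V → V → ℝ := fun S u => if u ∈ S then 0 else 1
  let z : V → ℝ := fun _ => 0
  let o : V → ℝ := fun _ => 1
  intro P hPmem
  simp only [List.mem_cons, List.not_mem_nil, or_false] at hPmem
  rcases hPmem with rfl | rfl | rfl | rfl | rfl | rfl | rfl | rfl | rfl | rfl | rfl | rfl <;>
    refine key _ fun S => ?_
  · refine ⟨ind S, ind S, ind S, ind S, z, z, fun e => ?_⟩
    by_cases h1 : e.1 ∈ S <;> by_cases h2 : e.2 ∈ S <;>
      simp [ind, z, pCut, h1, h2] <;> norm_num
  · refine ⟨ind S, cind S, ind S, cind S, z, z, fun e => ?_⟩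
    by_cases h1 : e.1 ∈ S <;> by_cases h2 : e.2 ∈ S <;>
      simp [ind, cind, z, pUnCut, h1, h2] <;> norm_num
  · refine ⟨ind S, z, z, ind S, ind S, ind S, fun e => ?_⟩
    by_cases h1 : e.1 ∈ S <;> by_cases h2 : e.2 ∈ S <;>
      simp [ind, z, pOr, h1, h2] <;> norm_num
  · refine ⟨cind S, z, z, cind S, ind S, ind S, fun e => ?_⟩
    by_cases h1 : e.1 ∈ S <;> by_cases h2 : e.2 ∈ S <;>
      simp [ind, cind, z, pNAnd, h1, h2] <;> norm_num
  · refine ⟨cind S, z, z, ind S, ind S, cind S, fun e => ?_⟩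
    by_cases h1 : e.1 ∈ S <;> by_cases h2 : e.2 ∈ S <;>
      simp [ind, cind, z, pBar10, h1, h2] <;> norm_num
  · refine ⟨ind S, z, z, cind S, ind S, cind S, fun e => ?_⟩
    by_cases h1 : e.1 ∈ S <;> by_cases h2 : e.2 ∈ S <;>
      simp [ind, cind, z, pBar01, h1, h2] <;> norm_num
  · refine ⟨ind S, z, ind S, z, z, z, fun e => ?_⟩
    by_cases h1 : e.1 ∈ S <;> simp [ind, z, p1x, h1] <;> norm_num
  · refine ⟨cind S, z, cind S, z, z, z, fun e => ?_⟩
    by_cases h1 : e.1 ∈ S <;> simp [cind, z, p0x, h1] <;> norm_num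
  · refine ⟨z, ind S, z, ind S, z, z, fun e => ?_⟩
    by_cases h1 : e.2 ∈ S <;> simp [ind, z, px1, h1] <;> norm_num
  · refine ⟨z, cind S, z, cind S, z, z, fun e => ?_⟩
    by_cases h1 : e.2 ∈ S <;> simp [cind, z, px0, h1] <;> norm_num
  · refine ⟨o, z, o, z, z, z, fun e => ?_⟩
    simp [o, z, pOne]; norm_num
  · refine ⟨z, z, z, z, z, z, fun e => ?_⟩
    simp [z, pZero]
end

section
/- There is a constant C > 0 such that for every ε ∈ (0,1) and every VCSP instance I = (V, Π, w) in which no constraint uses a predicate from {nOr, 01, Dicut, And}, there exists an ε-sparsifier I_ε of I with at most C·|V|/ε² constraints. -/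
/-- `And(x,y) = 1` iff `x = y = 1`. -/
def pAnd : Pred := fun x y => x && y
/-- `nOr(x,y) = 1` iff `x = y = 0`. -/
def pNOr : Pred := fun x y => !(x || y)
/-- `Dicut(x,y) = 1` iff `(x,y) = (1,0)`. -/
def pDicut : Pred := fun x y => x && !y
/-- `01(x,y) = 1` iff `(x,y) = (0,1)`. -/
def p01 : Pred := fun x y => !x && y

/-- The value `Val_I(A)` of an assignment `A` on the VCSP instance with constraint set
`Cs` (each constraint is an ordered pair of variables with a predicate) and weights `w`. -/
def vcspVal {V : Type} (Cs : Finset (V × V × Pred)) (w : V × V × Pred → ℝ)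
    (A : V → Bool) : ℝ :=
  ∑ c ∈ Cs, if c.2.2 (A c.1) (A c.2.1) then w c else 0

section BSS
open Matrix
open scoped ComplexOrder

variable {k : ℕ}

/-- The rank one matrix `v v*`. -/
def rk (v : Fin k → ℂ) : Matrix (Fin k) (Fin k) ℂ := vecMulVec v (star v)

/-- Real part of the trace. -/
def rtr (M : Matrix (Fin k) (Fin k) ℂ) : ℝ := M.trace.re

lemma rtr_add (M N : Matrix (Fin k) (Fin k) ℂ) : rtr (M + N) = rtr M + rtr N := by
  simp [rtr]
lemma rtr_sub (M N : Matrix (Fin k) (Fin k) ℂ) : rtr (M - N) = rtr M - rtr N := by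
  simp [rtr]
lemma rtr_smul (t : ℝ) (M : Matrix (Fin k) (Fin k) ℂ) : rtr (t • M) = t * rtr M := by
  simp [rtr, trace_smul]
lemma rtr_comm (M N : Matrix (Fin k) (Fin k) ℂ) : rtr (M * N) = rtr (N * M) := by
  simp only [rtr, trace_mul_comm M N]
lemma rtr_sum {ι : Type*} (s : Finset ι) (f : ι → Matrix (Fin k) (Fin k) ℂ) :
    rtr (∑ i ∈ s, f i) = ∑ i ∈ s, rtr (f i) := by
  simp [rtr, trace_sum]
lemma rtr_nonneg {M : Matrix (Fin k) (Fin k) ℂ} (h : M.PosSemidef) : 0 ≤ rtr M :=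
  (Complex.le_def.1 h.trace_nonneg).1

lemma psd_rk (v : Fin k → ℂ) : (rk v).PosSemidef := posSemidef_vecMulVec_self_star v

lemma psd_smul {M : Matrix (Fin k) (Fin k) ℂ} (h : M.PosSemidef) {t : ℝ} (ht : 0 ≤ t) :
    (t • M).PosSemidef := h.smul ht
lemma pd_smul {M : Matrix (Fin k) (Fin k) ℂ} (h : M.PosDef) {t : ℝ} (ht : 0 < t) :
    (t • M).PosDef := h.smul ht

lemma psd_conj {M N : Matrix (Fin k) (Fin k) ℂ} (hN : N.PosSemidef) (hM : M.IsHermitian) :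
    (M * N * M).PosSemidef := by
  have := hN.mul_mul_conjTranspose_same M
  rwa [hM.eq] at this

lemma rtr_sq_pos [Nonempty (Fin k)] {M : Matrix (Fin k) (Fin k) ℂ} (h : M.PosDef) :
    0 < rtr (M * M) := by
  have h1 : (M * M).PosDef := by
    have := PosDef.conjTranspose_mul_self M (mulVec_injective_iff_isUnit.2 h.isUnit)
    rwa [h.isHermitian.eq] at this
  exact (Complex.lt_def.1 h1.trace_pos).1

lemma rtr_mul_rk (M : Matrix (Fin k) (Fin k) ℂ) (v : Fin k → ℂ) :
    rtr (M * rk v) = (star v ⬝ᵥ M *ᵥ v).re := by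
  rw [rtr, rk, mul_vecMulVec, trace_vecMulVec, dotProduct_comm]

lemma rk_mul_rk {M : Matrix (Fin k) (Fin k) ℂ} (h : M.IsHermitian) (v : Fin k → ℂ) :
    rk v * M * rk v = rtr (M * rk v) • rk v := by
  have h1 : ((rtr (M * rk v) : ℝ) : ℂ) = star v ⬝ᵥ M *ᵥ v := by
    have h2 : (M * rk v).trace = star v ⬝ᵥ M *ᵥ v := by
      rw [rk, mul_vecMulVec, trace_vecMulVec, dotProduct_comm]
    have h3 : star (star v ⬝ᵥ M *ᵥ v) = star v ⬝ᵥ M *ᵥ v := by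
      rw [← star_dotProduct_star, star_star, star_mulVec, h.eq, dotProduct_comm, dotProduct_mulVec,
        dotProduct_comm]
    rw [rtr, h2]
    exact (Complex.conj_eq_iff_re.1 h3)
  have : rtr (M * rk v) • rk v = ((rtr (M * rk v) : ℝ) : ℂ) • rk v := by
    ext i j; simp
  rw [this, h1, rk, Matrix.mul_assoc, mul_vecMulVec, vecMulVec_mul_vecMulVec, vecMulVec_smul]

/-- Upper barrier shift. -/
lemma upper_shift [Nonempty (Fin k)] {M P : Matrix (Fin k) (Fin k) ℂ} (hM : M.PosDef)
    (hMP : M * P = 1) {δ : ℝ} (hδ : 0 < δ) :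
    ∃ N : Matrix (Fin k) (Fin k) ℂ, N.PosDef ∧ N * (P + δ • 1) = 1 ∧
      δ * rtr (N * N) ≤ rtr M - rtr N ∧ 0 < rtr (N * N) := by
  have hP : P.PosDef := by
    rw [← inv_eq_right_inv hMP]; exact hM.inv
  have hQ : (P + δ • (1 : Matrix (Fin k) (Fin k) ℂ)).PosDef := hP.add (pd_smul PosDef.one hδ)
  set Q := P + δ • (1 : Matrix (Fin k) (Fin k) ℂ) with hQd
  have hN := hQ.inv
  have hNQ : Q⁻¹ * Q = 1 := nonsing_inv_mul _ ((isUnit_iff_isUnit_det _).1 hQ.isUnit)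
  have hQN : Q * Q⁻¹ = 1 := mul_nonsing_inv _ ((isUnit_iff_isUnit_det _).1 hQ.isUnit)
  refine ⟨Q⁻¹, hN, hNQ, ?_, rtr_sq_pos hN⟩
  set N := Q⁻¹
  have hPM : P * M = 1 := mul_eq_one_comm.1 hMP
  have e1 : M = N + δ • (N * M) := by
    calc M = N * Q * M := by rw [hNQ, one_mul]
      _ = N * (P * M) + δ • (N * M) := by
        rw [hQd]; simp [mul_add, add_mul, Matrix.mul_assoc]
      _ = _ := by rw [hPM, mul_one]
  have e2 : M = N + δ • (M * N) := by
    calc M = M * (Q * N) := by rw [hQN, mul_one]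
      _ = (M * P) * N + δ • (M * N) := by
        rw [hQd]; simp [mul_add, add_mul, Matrix.mul_assoc]
      _ = _ := by rw [hMP, one_mul]
  have e3 : N * M = N * N + δ • (N * M * N) := by
    conv_lhs => rw [e2]
    simp [mul_add, Matrix.mul_assoc]
  have h1 := congrArg rtr e1
  have h3 := congrArg rtr e3
  rw [rtr_add, rtr_smul] at h1 h3
  have h4 := rtr_nonneg (psd_conj hM.posSemidef hN.isHermitian)
  have : 0 ≤ δ * (δ * rtr (N * M * N)) := by positivity
  nlinarith

lemma upper_update {M P : Matrix (Fin k) (Fin k) ℂ} (hM : M.PosDef)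
    (hMP : M * P = 1) (v : Fin k → ℂ) {t D : ℝ} (ht : 0 < t) (hD : 0 < D)
    (h : rtr (M * M * rk v) / D + rtr (M * rk v) < 1 / t) :
    ∃ N : Matrix (Fin k) (Fin k) ℂ, N.PosDef ∧ N * (P - t • rk v) = 1 ∧
      rtr N ≤ rtr M + D := by
  set q := rtr (M * rk v) with hq
  have hr : 0 ≤ rtr (M * M * rk v) := by
    have := rtr_nonneg (psd_conj (psd_rk v) hM.isHermitian)
    rwa [rtr_comm, ← Matrix.mul_assoc] at this
  set r := rtr (M * M * rk v)
  have hq1 : 0 < 1 / t - q := by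
    have : 0 ≤ r / D := by positivity
    linarith
  have hrD : r ≤ D * (1 / t - q) := by
    have : r / D ≤ 1 / t - q := by linarith
    rw [div_le_iff₀ hD] at this; linarith
  set c := 1 / (1 / t - q) with hc
  have hc0 : 0 < c := by positivity
  have hct : c - t - c * t * q = 0 := by
    have h0 : c * (1 / t - q) = 1 := by rw [hc]; exact one_div_mul_cancel hq1.ne'
    have h2 : c * (1 - t * q) = t := by
      have : c * (1 - t * q) = t * (c * (1 / t - q)) := by field_simp
      rw [this, h0, mul_one]
    linarith
  refine ⟨M + c • (M * rk v * M), hM.add_posSemidef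
    (psd_smul (psd_conj (psd_rk v) hM.isHermitian) hc0.le), ?_, ?_⟩
  · have e : (M + c • (M * rk v * M)) * (P - t • rk v) =
        M * P - t • (M * rk v) + c • (M * rk v * (M * P))
          - (c * t) • (M * (rk v * M * rk v)) := by
      simp only [add_mul, mul_sub, smul_mul_assoc, mul_smul_comm, Matrix.mul_assoc]
      module
    rw [e, hMP, rk_mul_rk hM.isHermitian, mul_one, mul_smul_comm, smul_smul, ← hq]
    have : (1 : Matrix (Fin k) (Fin k) ℂ) - t • (M * rk v) + c • (M * rk v)
        - (c * t * q) • (M * rk v) = 1 + (c - t - c * t * q) • (M * rk v) := by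
      module
    rw [this, hct]; simp
  · rw [rtr_add, rtr_smul]
    have e : rtr (M * rk v * M) = r := by rw [rtr_comm, ← Matrix.mul_assoc]
    rw [e]
    have : c * r ≤ D := by
      rw [hc, one_div, inv_mul_le_iff₀ hq1]; linarith
    linarith

lemma trace_sub_psd {M : Matrix (Fin k) (Fin k) ℂ} (hM : M.PosSemidef) :
    (rtr M • (1 : Matrix (Fin k) (Fin k) ℂ) - M).PosSemidef := by
  set U : Matrix (Fin k) (Fin k) ℂ := (hM.isHermitian.eigenvectorUnitary : Matrix (Fin k) (Fin k) ℂ) with hU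
  set l := hM.isHermitian.eigenvalues with hl
  have hUU : U * Uᴴ = 1 := by
    have := Unitary.coe_mul_star_self hM.isHermitian.eigenvectorUnitary
    exact this
  have h1 : M = U * diagonal (fun i => ((l i : ℝ) : ℂ)) * Uᴴ := by
    have := hM.isHermitian.spectral_theorem
    rw [Unitary.conjStarAlgAut_apply] at this
    exact this
  have h2 : rtr M = ∑ i, l i := by
    rw [rtr, hM.isHermitian.trace_eq_sum_eigenvalues]; simp [hl]
  have h3 : rtr M • (1 : Matrix (Fin k) (Fin k) ℂ) - M =
      U * diagonal (fun i => ((rtr M - l i : ℝ) : ℂ)) * Uᴴ := by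
    have : diagonal (fun i => ((rtr M - l i : ℝ) : ℂ)) =
      rtr M • (1 : Matrix (Fin k) (Fin k) ℂ) - diagonal (fun i => ((l i : ℝ) : ℂ)) := by
      ext i j
      by_cases h : i = j
      · subst h; simp
      · simp [h]
    rw [this, mul_sub, sub_mul, ← h1]
    simp [hUU]
  rw [h3]
  apply PosSemidef.mul_mul_conjTranspose_same
  apply PosSemidef.diagonal
  intro i
  have : l i ≤ ∑ i, l i := Finset.single_le_sum (f := l)
    (fun i _ => hM.eigenvalues_nonneg i) (Finset.mem_univ i)
  have h4 : 0 ≤ rtr M - l i := by rw [h2]; linarith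
  simpa using h4

/-- Lower barrier shift. -/
lemma lower_shift [Nonempty (Fin k)] {M P : Matrix (Fin k) (Fin k) ℂ} (hM : M.PosDef)
    (hMP : M * P = 1) {δ : ℝ} (hδ : 0 < δ) (htr : rtr M * δ < 1) :
    ∃ N : Matrix (Fin k) (Fin k) ℂ, N.PosDef ∧ N * (P - δ • 1) = 1 ∧
      0 < rtr N - rtr M ∧
      (1 / δ + rtr N - rtr M) * (rtr N - rtr M) ≤ rtr (N * N) := by
  have hK : ((1 : Matrix (Fin k) (Fin k) ℂ) - δ • M).PosDef := by
    have : (1 : Matrix (Fin k) (Fin k) ℂ) - δ • M =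
      (1 - rtr M * δ) • 1 + δ • (rtr M • (1 : Matrix (Fin k) (Fin k) ℂ) - M) := by module
    rw [this]
    exact (pd_smul PosDef.one (by linarith)).add_posSemidef
      (psd_smul (trace_sub_psd hM.posSemidef) hδ.le)
  set K := (1 : Matrix (Fin k) (Fin k) ℂ) - δ • M with hKd
  have hKK : K⁻¹ * K = 1 := nonsing_inv_mul _ ((isUnit_iff_isUnit_det _).1 hK.isUnit)
  have hPM : P * M = 1 := mul_eq_one_comm.1 hMP
  obtain ⟨N, hNd⟩ : ∃ N, N = M + δ • (M * K⁻¹ * M) := ⟨_, rfl⟩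
  have hN : N.PosDef := by
    rw [hNd]
    exact hM.add_posSemidef (psd_smul (psd_conj hK.inv.posSemidef hM.isHermitian) hδ.le)
  have hNQ : N * (P - δ • 1) = 1 := by
    have e : N * (P - δ • 1) = M * P - δ • M + δ • (M * (K⁻¹ * (M * P - δ • M))) := by
      rw [hNd]
      simp only [add_mul, mul_sub, smul_mul_assoc, mul_smul_comm, Matrix.mul_assoc, mul_one]
      module
    rw [e, hMP, ← hKd, hKK, mul_one, hKd]; abel
  have hQN := mul_eq_one_comm.1 hNQ
  have e1 : N = M + δ • (N * M) := by
    have : N * (P - δ • 1) * M = N - δ • (N * M) := by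
      rw [mul_sub, sub_mul, Matrix.mul_assoc, hPM]; simp
    rw [hNQ, one_mul] at this
    exact eq_add_of_sub_eq this.symm
  have e2 : N = M + δ • (M * N) := by
    have : M * ((P - δ • 1) * N) = N - δ • (M * N) := by
      rw [sub_mul, mul_sub, ← Matrix.mul_assoc, hMP]; simp
    rw [hQN, mul_one] at this
    exact eq_add_of_sub_eq this.symm
  have e3 : M * N = M * M + δ • (M * N * M) := by
    conv_lhs => rw [e1]
    simp [mul_add, Matrix.mul_assoc]
  have e4 : N * N = N * M + δ • (N * M * N) := by
    conv_lhs => rw [e2]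
    simp [mul_add, Matrix.mul_assoc]; rw [← e2]
  have h1 := congrArg rtr e1
  have h3 := congrArg rtr e3
  have h4 := congrArg rtr e4
  rw [rtr_add, rtr_smul] at h1 h3 h4
  have hc : rtr (M * N) = rtr (N * M) := rtr_comm _ _
  have p3 := rtr_nonneg (psd_conj hN.posSemidef hM.isHermitian)
  have pM := rtr_sq_pos hM
  set x := rtr (N * M) with hx
  have hxpos : 0 < x := by
    have : 0 ≤ δ * rtr (M * N * M) := by positivity
    linarith
  have p4 := rtr_nonneg (psd_conj hM.posSemidef hN.isHermitian)
  set y := rtr (N * M * N) with hy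
  have cs : x ^ 2 ≤ rtr M * y := by
    have key : ∀ s : ℝ, 0 ≤ rtr M - 2 * s * x + s ^ 2 * y := by
      intro s
      have hH : ((1 : Matrix (Fin k) (Fin k) ℂ) - s • N).IsHermitian := by
        have h1 : ((1 : Matrix (Fin k) (Fin k) ℂ)).IsHermitian := isHermitian_one
        refine h1.sub ?_
        rw [IsHermitian, conjTranspose_smul, hN.isHermitian.eq]; simp
      have := rtr_nonneg (psd_conj hM.posSemidef hH)
      have e : (1 - s • N) * M * (1 - s • N) =
          M - s • (N * M) - s • (M * N) + (s ^ 2) • (N * M * N) := by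
        simp only [sub_mul, mul_sub, one_mul, mul_one, smul_mul_assoc, mul_smul_comm]
        module
      rw [e, rtr_add, rtr_sub, rtr_sub, rtr_smul, rtr_smul, rtr_smul, hc] at this
      linarith
    have hd := discrim_le_zero (a := y) (b := -2 * x) (c := rtr M) (fun s => by
      have := key s; nlinarith)
    rw [discrim] at hd
    nlinarith
  refine ⟨N, hN, hNQ, ?_, ?_⟩
  · have : 0 < δ * x := by positivity
    linarith
  · have hd : rtr N - rtr M = δ * x := by linarith
    have : 1 / δ + rtr N - rtr M = 1 / δ + δ * x := by linarith
    rw [this, hd, h4]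
    have e5 : (1 / δ + δ * x) * (δ * x) = x + δ * (δ * x ^ 2) := by field_simp
    rw [e5]
    have h6 : δ * x ^ 2 ≤ y := by
      calc δ * x ^ 2 ≤ δ * (rtr M * y) := by gcongr
        _ = (rtr M * δ) * y := by ring
        _ ≤ 1 * y := by gcongr
        _ = y := one_mul y
    have := mul_le_mul_of_nonneg_left h6 hδ.le
    linarith

lemma lower_update {M P : Matrix (Fin k) (Fin k) ℂ} (hM : M.PosDef)
    (hMP : M * P = 1) (v : Fin k → ℂ) {t D : ℝ} (ht : 0 < t) (hD : 0 < D)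
    (h : 1 / t ≤ rtr (M * M * rk v) / D - rtr (M * rk v)) :
    ∃ N : Matrix (Fin k) (Fin k) ℂ, N.PosDef ∧ N * (P + t • rk v) = 1 ∧
      rtr N ≤ rtr M - D := by
  have hP : P.PosDef := by
    rw [← inv_eq_right_inv hMP]; exact hM.inv
  have hq0 : 0 ≤ rtr (M * rk v) := by
    rw [rtr_mul_rk]; exact hM.posSemidef.re_dotProduct_nonneg v
  set q := rtr (M * rk v) with hq
  set r := rtr (M * M * rk v)
  have hq1 : 0 < 1 / t + q := by positivity
  have hrD : D * (1 / t + q) ≤ r := by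
    have : 1 / t + q ≤ r / D := by linarith
    rw [le_div_iff₀ hD] at this; linarith
  set c := 1 / (1 / t + q) with hc
  have hct : -c + t - c * t * q = 0 := by
    have h0 : c * (1 / t + q) = 1 := by rw [hc]; exact one_div_mul_cancel hq1.ne'
    have h2 : c * (1 + t * q) = t := by
      have : c * (1 + t * q) = t * (c * (1 / t + q)) := by field_simp
      rw [this, h0, mul_one]
    linarith
  have hmul : (M - c • (M * rk v * M)) * (P + t • rk v) = 1 := by
    have e : (M - c • (M * rk v * M)) * (P + t • rk v) =
        M * P + t • (M * rk v) - c • (M * rk v * (M * P))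
          - (c * t) • (M * (rk v * M * rk v)) := by
      simp only [sub_mul, mul_add, smul_mul_assoc, mul_smul_comm, Matrix.mul_assoc]
      module
    rw [e, hMP, rk_mul_rk hM.isHermitian, mul_one, mul_smul_comm, smul_smul, ← hq]
    have : (1 : Matrix (Fin k) (Fin k) ℂ) + t • (M * rk v) - c • (M * rk v)
        - (c * t * q) • (M * rk v) = 1 + (-c + t - c * t * q) • (M * rk v) := by
      module
    rw [this, hct]; simp
  refine ⟨M - c • (M * rk v * M), ?_, hmul, ?_⟩
  · rw [← inv_eq_left_inv hmul]
    exact (hP.add_posSemidef (psd_smul (psd_rk v) ht.le)).inv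
  · rw [rtr_sub, rtr_smul]
    have e : rtr (M * rk v * M) = r := by rw [rtr_comm, ← Matrix.mul_assoc]
    rw [e]
    have : D ≤ c * r := by
      rw [hc, one_div, le_inv_mul_iff₀ hq1]; linarith
    linarith

/-- One step of the barrier argument. -/
lemma bss_step_s9 [Nonempty (Fin k)] {ι : Type*} [Fintype ι] (r : ι → Fin k → ℂ)
    (hr : ∑ i, rk (r i) = 1) {η : ℝ} (hη : 0 < η) (hη1 : η < 1 / 4)
    {A M N : Matrix (Fin k) (Fin k) ℂ} {u l : ℝ} (hM : M.PosDef) (hN : N.PosDef)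
    (hMA : M * (u • 1 - A) = 1) (hNA : N * (A - l • 1) = 1) (hMt : rtr M ≤ η)
    (hNt : rtr N ≤ η) :
    ∃ (i : ι) (t : ℝ) (M' N' : Matrix (Fin k) (Fin k) ℂ), 0 < t ∧ M'.PosDef ∧ N'.PosDef ∧
      M' * ((u + (1 + 4 * η)) • 1 - (A + t • rk (r i))) = 1 ∧
      N' * ((A + t • rk (r i)) - (l + 1) • 1) = 1 ∧ rtr M' ≤ η ∧ rtr N' ≤ η := by
  have hδ : 0 < 1 + 4 * η := by linarith
  obtain ⟨M1, hM1, hM1A, hM1t, hM1p⟩ := upper_shift hM hMA hδ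
  obtain ⟨N1, hN1, hN1A, hN1p, hN1t⟩ := lower_shift hN hNA one_pos (by linarith)
  have sumtr : ∀ B : Matrix (Fin k) (Fin k) ℂ, ∑ i, rtr (B * rk (r i)) = rtr B := by
    intro B
    rw [← rtr_sum, ← Finset.mul_sum, hr, mul_one]
  have hDU : 0 < rtr M - rtr M1 := lt_of_lt_of_le (by positivity) hM1t
  set DU := rtr M - rtr M1 with hDUd
  set DL := rtr N1 - rtr N with hDLd
  have hU : rtr (M1 * M1) / DU ≤ 1 / (1 + 4 * η) := by
    rw [div_le_div_iff₀ hDU hδ]; linarith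
  have hL : 1 + DL ≤ rtr (N1 * N1) / DL := by
    rw [le_div_iff₀ hN1p]
    have : 1 / 1 + rtr N1 - rtr N = 1 + DL := by rw [hDLd]; ring
    rw [this] at hN1t; exact hN1t
  have hpar : 1 / (1 + 4 * η) < 1 - 2 * η := by
    rw [div_lt_iff₀ hδ]; nlinarith
  obtain ⟨i, -, hi⟩ : ∃ i ∈ Finset.univ,
      rtr (M1 * M1 * rk (r i)) / DU + rtr (M1 * rk (r i)) <
        rtr (N1 * N1 * rk (r i)) / DL - rtr (N1 * rk (r i)) := by
    apply Finset.exists_lt_of_sum_lt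
    rw [Finset.sum_add_distrib, Finset.sum_sub_distrib, ← Finset.sum_div, ← Finset.sum_div,
      sumtr, sumtr, sumtr, sumtr]
    linarith
  set X := rtr (N1 * N1 * rk (r i)) / DL - rtr (N1 * rk (r i)) with hX
  have hXpos : 0 < X := by
    have h1 : 0 ≤ rtr (M1 * M1 * rk (r i)) := by
      have := rtr_nonneg (psd_conj (psd_rk (r i)) hM1.isHermitian)
      rwa [rtr_comm, ← Matrix.mul_assoc] at this
    have h2 : 0 ≤ rtr (M1 * rk (r i)) := by
      rw [rtr_mul_rk]; exact hM1.posSemidef.re_dotProduct_nonneg _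
    have : 0 ≤ rtr (M1 * M1 * rk (r i)) / DU := by positivity
    linarith
  have ht : 0 < 1 / X := by positivity
  obtain ⟨M2, hM2, hM2A, hM2t⟩ := upper_update hM1 hM1A (r i) ht hDU (by simpa using hi)
  obtain ⟨N2, hN2, hN2A, hN2t⟩ := lower_update hN1 hN1A (r i) ht hN1p (by simp [hX])
  refine ⟨i, 1 / X, M2, N2, ht, hM2, hN2, ?_, ?_, by linarith, by linarith⟩
  · refine Eq.trans ?_ hM2A; congr 1; module
  · refine Eq.trans ?_ hN2A; congr 1; module

lemma bss_iter_s9 [Nonempty (Fin k)] {ι : Type*} [Fintype ι] (r : ι → Fin k → ℂ)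
    (hr : ∑ i, rk (r i) = 1) {η : ℝ} (hη : 0 < η) (hη1 : η < 1 / 4) {n : ℝ} (hn : (k : ℝ) ≤ n)
    (q : ℕ) :
    ∃ (s : ι → ℝ) (S : Finset ι) (M N : Matrix (Fin k) (Fin k) ℂ),
      (∀ i, 0 ≤ s i) ∧ (∀ i, i ∉ S → s i = 0) ∧ S.card ≤ q ∧
      M.PosDef ∧ N.PosDef ∧
      M * ((n / η + q * (1 + 4 * η)) • 1 - ∑ i, s i • rk (r i)) = 1 ∧
      N * (∑ i, s i • rk (r i) - (-(n / η) + q) • 1) = 1 ∧ rtr M ≤ η ∧ rtr N ≤ η := by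
  classical
  induction q with
  | zero =>
    have hk : (0 : ℝ) < k := by
      have : 0 < k := Fin.pos_iff_nonempty.2 ‹_›
      exact_mod_cast this
    have hn0 : 0 < n := by linarith
    have hpd : ((η / n) • (1 : Matrix (Fin k) (Fin k) ℂ)).PosDef :=
      pd_smul PosDef.one (by positivity)
    have hmul : n / η * (η / n) = 1 := by field_simp
    have htr : rtr ((η / n) • (1 : Matrix (Fin k) (Fin k) ℂ)) ≤ η := by
      rw [rtr_smul]
      simp only [rtr, trace_one, Fintype.card_fin, Complex.natCast_re]
      rw [div_mul_eq_mul_div, div_le_iff₀ hn0]; gcongr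
    refine ⟨0, ∅, (η / n) • 1, (η / n) • 1, by simp, by simp, by simp, hpd, hpd, ?_, ?_, htr, htr⟩
    · simp [smul_smul, hmul]
    · simp [smul_smul, hmul]
  | succ q ih =>
    obtain ⟨s, S, M, N, hs, hS, hq, hM, hN, hMA, hNA, hMt, hNt⟩ := ih
    obtain ⟨i, t, M', N', ht, hM', hN', hMA', hNA', hMt', hNt'⟩ :=
      bss_step_s9 r hr hη hη1 hM hN hMA hNA hMt hNt
    have hsum : ∑ j, (s j + if j = i then t else 0) • rk (r j) =
        ∑ j, s j • rk (r j) + t • rk (r i) := by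
      simp [add_smul, Finset.sum_add_distrib, ite_smul]
    refine ⟨fun j => s j + if j = i then t else 0, insert i S, M', N', ?_, ?_, ?_, hM', hN',
      ?_, ?_, hMt', hNt'⟩
    · intro j
      have := hs j
      dsimp only
      split_ifs <;> linarith
    · intro j hj
      rw [Finset.mem_insert, not_or] at hj
      simp [hj.1, hS j hj.2]
    · exact (Finset.card_insert_le _ _).trans (by omega)
    · rw [hsum]; refine Eq.trans ?_ hMA'; congr 3; push_cast; ring
    · rw [hsum]; refine Eq.trans ?_ hNA'; congr 3; push_cast; ring

lemma pd_of_inv {M P : Matrix (Fin k) (Fin k) ℂ} (hM : M.PosDef) (hMP : M * P = 1) :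
    P.PosDef := by
  rw [← inv_eq_right_inv hMP]; exact hM.inv

lemma rtr_rk (y : Fin k → ℂ) : rtr (rk y) = ∑ j, ‖y j‖ ^ 2 := by
  rw [rtr, rk, trace_vecMulVec, dotProduct]
  simp only [Pi.star_apply, Complex.re_sum]
  refine Finset.sum_congr rfl fun j _ => ?_
  rw [← Complex.normSq_eq_norm_sq]
  simp [Complex.normSq_apply]

lemma rtr_rk_rk (x y : Fin k → ℂ) : rtr (rk x * rk y) = ‖star x ⬝ᵥ y‖ ^ 2 := by
  rw [rtr, rk, rk, vecMulVec_mul_vecMulVec, vecMulVec_smul, trace_smul, trace_vecMulVec,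
    ← Complex.normSq_eq_norm_sq]
  have : x ⬝ᵥ star y = star (star x ⬝ᵥ y) := by
    rw [← star_dotProduct_star, star_star, dotProduct_comm]
  rw [this, smul_eq_mul]
  simp [Complex.normSq_apply]

theorem bss {ι : Type*} [Fintype ι] (r : ι → Fin k → ℂ)
    (hr : ∑ i, rk (r i) = 1) {ε : ℝ} (hε : 0 < ε) (hε1 : ε < 1) {n : ℕ} (hn : k ≤ n) (hn0 : 0 < n) :
    ∃ (s : ι → ℝ) (S : Finset ι), (∀ i, 0 ≤ s i) ∧ (∀ i, i ∉ S → s i = 0) ∧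
      (S.card : ℝ) ≤ 65 * n / ε ^ 2 ∧ ∀ y : Fin k → ℂ,
        (1 - ε) * ∑ j, ‖y j‖ ^ 2 ≤ ∑ i, s i * ‖star (r i) ⬝ᵥ y‖ ^ 2 ∧
        ∑ i, s i * ‖star (r i) ⬝ᵥ y‖ ^ 2 ≤ (1 + ε) * ∑ j, ‖y j‖ ^ 2 := by
  rcases Nat.eq_zero_or_pos k with rfl | hk
  · refine ⟨0, ∅, by simp, by simp, ?_, ?_⟩
    · simp; positivity
    · intro y; simp
  have : Nonempty (Fin k) := Fin.pos_iff_nonempty.1 hk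
  have hη : 0 < ε / 8 := by positivity
  obtain ⟨q, hq⟩ : ∃ q : ℕ, q = ⌈(n : ℝ) / (ε / 8) ^ 2⌉₊ := ⟨_, rfl⟩
  have hnR : (1 : ℝ) ≤ n := by exact_mod_cast hn0
  have hq1 : (n : ℝ) / (ε / 8) ^ 2 ≤ q := by rw [hq]; exact Nat.le_ceil _
  have hq2 : (q : ℝ) ≤ n / (ε / 8) ^ 2 + 1 := by
    rw [hq]; exact (Nat.ceil_lt_add_one (by positivity)).le
  have hq0 : (0 : ℝ) < q := lt_of_lt_of_le (by positivity) hq1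
  obtain ⟨s, S, M, N, hs, hS, hc, hM, hN, hMA, hNA, -, -⟩ :=
    bss_iter_s9 r hr hη (by linarith) (n := n) (by exact_mod_cast hn) q
  have hnq : (n : ℝ) / (ε / 8) ≤ q * (ε / 8) := by
    rw [div_le_iff₀ (by positivity)] at hq1 ⊢
    linarith
  have hU := pd_of_inv hM hMA
  have hL := pd_of_inv hN hNA
  refine ⟨fun i => s i / q, S, fun i => div_nonneg (hs i) hq0.le, fun i hi => by simp [hS i hi],
    ?_, ?_⟩
  · have h1 : (S.card : ℝ) ≤ q := by exact_mod_cast hc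
    refine h1.trans (hq2.trans ?_)
    have e : (65 : ℝ) * n / ε ^ 2 = n / (ε / 8) ^ 2 + n / ε ^ 2 := by field_simp; norm_num
    rw [e]
    have : 1 ≤ (n : ℝ) / ε ^ 2 := by
      rw [le_div_iff₀ (by positivity)]
      nlinarith
    linarith
  · intro y
    have h1 := hU.posSemidef.re_dotProduct_nonneg y
    have h2 := hL.posSemidef.re_dotProduct_nonneg y
    have key : ∀ B : Matrix (Fin k) (Fin k) ℂ, RCLike.re (star y ⬝ᵥ B *ᵥ y) = rtr (B * rk y) :=
      fun B => (rtr_mul_rk B y).symm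
    have hsum : rtr ((∑ i, s i • rk (r i)) * rk y) = ∑ i, s i * ‖star (r i) ⬝ᵥ y‖ ^ 2 := by
      rw [Finset.sum_mul, rtr_sum]
      refine Finset.sum_congr rfl fun i _ => ?_
      rw [smul_mul_assoc, rtr_smul, rtr_rk_rk]
    rw [key, sub_mul, rtr_sub, hsum, smul_mul_assoc, one_mul, rtr_smul, rtr_rk] at h1 h2
    have hY : 0 ≤ ∑ j, ‖y j‖ ^ 2 := by positivity
    have e : ∑ i, s i / q * ‖star (r i) ⬝ᵥ y‖ ^ 2 = (∑ i, s i * ‖star (r i) ⬝ᵥ y‖ ^ 2) / q := by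
      rw [Finset.sum_div]
      exact Finset.sum_congr rfl fun i _ => by ring
    rw [e]
    set Y := ∑ j, ‖y j‖ ^ 2
    set Z := ∑ i, s i * ‖star (r i) ⬝ᵥ y‖ ^ 2
    constructor
    · rw [le_div_iff₀ hq0]
      have a1 : (1 - ε) * q ≤ -(n / (ε / 8)) + q := by nlinarith
      have := mul_le_mul_of_nonneg_right a1 hY
      linarith
    · rw [div_le_iff₀ hq0]
      have a1 : n / (ε / 8) + q * (1 + 4 * (ε / 8)) ≤ (1 + ε) * q := by nlinarith
      have := mul_le_mul_of_nonneg_right a1 hY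
      linarith

theorem sparsify_forms {ι : Type*} [Fintype ι] {E : Type*} [AddCommGroup E] [Module ℂ E]
    [FiniteDimensional ℂ E] (f : ι → E →ₗ[ℂ] ℂ) {ε : ℝ} (hε : 0 < ε) (hε1 : ε < 1)
    {n : ℕ} (hn : Module.finrank ℂ E ≤ n) (hn0 : 0 < n) :
    ∃ (s : ι → ℝ) (S : Finset ι), (∀ i, 0 ≤ s i) ∧ (∀ i, i ∉ S → s i = 0) ∧
      (S.card : ℝ) ≤ 65 * n / ε ^ 2 ∧ ∀ x : E,
        (1 - ε) * ∑ i, ‖f i x‖ ^ 2 ≤ ∑ i, s i * ‖f i x‖ ^ 2 ∧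
        ∑ i, s i * ‖f i x‖ ^ 2 ≤ (1 + ε) * ∑ i, ‖f i x‖ ^ 2 := by
  classical
  let T : E →ₗ[ℂ] EuclideanSpace ℂ ι :=
    (WithLp.linearEquiv 2 ℂ (ι → ℂ)).symm.toLinearMap ∘ₗ LinearMap.pi f
  have hT : ∀ x i, T x i = f i x := fun x i => rfl
  let R := LinearMap.range T
  obtain ⟨b⟩ : Nonempty (OrthonormalBasis (Fin (Module.finrank ℂ R)) ℂ R) :=
    ⟨stdOrthonormalBasis ℂ R⟩
  have hk : Module.finrank ℂ R ≤ n := (LinearMap.finrank_range_le T).trans hn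
  let r : ι → Fin (Module.finrank ℂ R) → ℂ := fun i j => star ((b j : EuclideanSpace ℂ ι) i)
  have hr : ∑ i, rk (r i) = 1 := by
    ext j j'
    have h := orthonormal_iff_ite.1 b.orthonormal j j'
    rw [Submodule.coe_inner, PiLp.inner_apply] at h
    rw [Matrix.sum_apply, one_apply, ← h]
    refine Finset.sum_congr rfl fun i _ => ?_
    simp [rk, vecMulVec_apply, r, mul_comm]
  obtain ⟨s, S, hs, hS, hc, hy⟩ := bss r hr hε hε1 hk hn0
  refine ⟨s, S, hs, hS, hc, fun x => ?_⟩
  let z : R := ⟨T x, LinearMap.mem_range_self T x⟩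
  have h1 : ∀ i, star (r i) ⬝ᵥ (fun j => b.repr z j) = f i x := by
    intro i
    have h : ((∑ j, b.repr z j • b j : R) : EuclideanSpace ℂ ι) = T x := by rw [b.sum_repr]
    rw [← hT, ← h, Submodule.coe_sum, WithLp.ofLp_sum, Finset.sum_apply]
    refine Finset.sum_congr rfl fun j _ => ?_
    rw [Submodule.coe_smul, PiLp.smul_apply, smul_eq_mul, mul_comm]
    simp only [Pi.star_apply, r, star_star]
  have h2 : ∑ j, ‖b.repr z j‖ ^ 2 = ∑ i, ‖f i x‖ ^ 2 := by
    rw [← EuclideanSpace.norm_sq_eq, b.repr.norm_map]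
    change ‖T x‖ ^ 2 = _
    rw [EuclideanSpace.norm_sq_eq]
    simp only [hT]
  have := hy (fun j => b.repr z j)
  simp only [h1] at this
  rwa [h2] at this

end BSS

/-- A boolean as a complex number. -/
def bc (x : Bool) : ℂ := if x then 1 else 0

lemma exists_omega : ∃ ω : ℂ, ‖ω‖ = 1 ∧ ‖1 + ω‖ = 1 := by
  have h3 : (√3 : ℝ) ^ 2 = 3 := Real.sq_sqrt (by norm_num)
  refine ⟨⟨-1/2, √3 / 2⟩, ?_, ?_⟩
  · rw [← sq_eq_sq₀ (norm_nonneg _) zero_le_one, ← Complex.normSq_eq_norm_sq, Complex.normSq_apply]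
    nlinarith
  · rw [← sq_eq_sq₀ (norm_nonneg _) zero_le_one, ← Complex.normSq_eq_norm_sq, Complex.normSq_apply]
    simp only [Complex.add_re, Complex.add_im, Complex.one_re, Complex.one_im]
    nlinarith

/-- Every allowed predicate is the squared modulus of an affine form. -/
lemma pred_form (P : Pred) (hP : P ∉ ([pNOr, p01, pDicut, pAnd] : List Pred)) :
    ∃ a b c : ℂ, ∀ x y, ‖a + b * bc x + c * bc y‖ ^ 2 = if P x y then (1 : ℝ) else 0 := by
  obtain ⟨ω, h1, h2⟩ := exists_omega
  have ext : ∀ Q : Pred, P false false = Q false false → P false true = Q false true →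
      P true false = Q true false → P true true = Q true true → P = Q := by
    intro Q h1 h2 h3 h4
    funext x y
    cases x <;> cases y <;> assumption
  simp only [List.mem_cons, List.not_mem_nil, or_false, not_or] at hP
  obtain ⟨n1, n2, n3, n4⟩ := hP
  have h3 : ‖(-1 : ℂ) - ω‖ = 1 := by rw [← h2, ← norm_neg]; congr 1; ring
  have h4 : ‖ω + 1‖ = 1 := by rw [← h2]; congr 1; ring
  rcases e1 : P false false <;> rcases e2 : P false true <;> rcases e3 : P true false <;>
    rcases e4 : P true true
  · exact ⟨0, 0, 0, by simp [bc, e1, e2, e3, e4]⟩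
  · exact absurd (ext pAnd (by simp [e1, pAnd]) (by simp [e2, pAnd]) (by simp [e3, pAnd])
      (by simp [e4, pAnd])) n4
  · exact absurd (ext pDicut (by simp [e1, pDicut]) (by simp [e2, pDicut]) (by simp [e3, pDicut])
      (by simp [e4, pDicut])) n3
  · exact ⟨0, 1, 0, by simp [bc, e1, e2, e3, e4]⟩
  · exact absurd (ext p01 (by simp [e1, p01]) (by simp [e2, p01]) (by simp [e3, p01])
      (by simp [e4, p01])) n2
  · exact ⟨0, 0, 1, by simp [bc, e1, e2, e3, e4]⟩
  · exact ⟨0, 1, -1, by simp [bc, e1, e2, e3, e4]⟩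
  · exact ⟨0, 1, ω, by simp [bc, e1, e2, e3, e4, h1, h2]⟩
  · exact absurd (ext pNOr (by simp [e1, pNOr]) (by simp [e2, pNOr]) (by simp [e3, pNOr])
      (by simp [e4, pNOr])) n1
  · exact ⟨1, -1, -1, by simp [bc, e1, e2, e3, e4]⟩
  · exact ⟨1, 0, -1, by simp [bc, e1, e2, e3, e4]⟩
  · exact ⟨1, ω, -1, by simp [bc, e1, e2, e3, e4, h1, h2]⟩
  · exact ⟨1, -1, 0, by simp [bc, e1, e2, e3, e4]⟩
  · exact ⟨1, -1, ω, by simp [bc, e1, e2, e3, e4, h1, h2]⟩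
  · exact ⟨1 + ω, -1, -ω, by simp [bc, e1, e2, e3, e4, h1, h2]⟩
  · exact ⟨1, 0, 0, by simp [bc, e1, e2, e3, e4]⟩

/-- There is a constant `C > 0` such that for every `ε ∈ (0,1)` and
every VCSP instance `I = (V, Cs, w)` (with strictly positive weights) in which no
constraint uses a predicate from `{nOr, 01, Dicut, And}`, there exists an `ε`-sparsifier
of `I` with at most `C·|V|/ε²` constraints. -/
theorem stmt9 :
    ∃ C : ℝ, 0 < C ∧
      ∀ (V : Type) [Fintype V]
        (Cs : Finset (V × V × Pred)) (w : V × V × Pred → ℝ),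
        (∀ c ∈ Cs, 0 < w c) →
        (∀ c ∈ Cs, c.2.2 ∉ ([pNOr, p01, pDicut, pAnd] : List Pred)) →
        ∀ ε : ℝ, ε ∈ Set.Ioo (0 : ℝ) 1 →
          ∃ (Csε : Finset (V × V × Pred)) (wε : V × V × Pred → ℝ),
            Csε ⊆ Cs ∧ (∀ c ∈ Csε, 0 < wε c) ∧
            (Csε.card : ℝ) ≤ C * (Fintype.card V) / ε ^ 2 ∧
            ∀ A : V → Bool,
              (1 - ε) * vcspVal Cs w A ≤ vcspVal Csε wε A ∧
                vcspVal Csε wε A ≤ (1 + ε) * vcspVal Cs w A := by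
  classical
  refine ⟨130, by norm_num, ?_⟩
  intro V _ Cs w hw hP ε hε
  rcases isEmpty_or_nonempty V with hV | hV
  · have hCs : Cs = ∅ := Finset.eq_empty_of_forall_notMem fun c _ => hV.elim c.1
    subst hCs
    exact ⟨∅, w, by simp, by simp, by simp, by simp [vcspVal]⟩
  have hch : ∀ c : Cs, ∃ a b d : ℂ, ∀ x y,
      ‖a + b * bc x + d * bc y‖ ^ 2 = if c.1.2.2 x y then (1 : ℝ) else 0 :=
    fun c => pred_form _ (hP c.1 c.2)
  choose a b d habd using hch
  let f : Cs → (Option V → ℂ) →ₗ[ℂ] ℂ := fun c =>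
    ((√(w c.1) : ℝ) : ℂ) • (a c • LinearMap.proj none + b c • LinearMap.proj (some c.1.1)
      + d c • LinearMap.proj (some c.1.2.1))
  obtain ⟨s, S, hs, hS, hc, hx⟩ := sparsify_forms f hε.1 hε.2
    (n := Fintype.card V + 1) (by simp) (by omega)
  let X : (V → Bool) → Option V → ℂ := fun A o => o.elim 1 (fun v => bc (A v))
  have hf : ∀ A (c : Cs), ‖f c (X A)‖ ^ 2 =
      if c.1.2.2 (A c.1.1) (A c.1.2.1) then w c.1 else 0 := by
    intro A c
    have h0 : f c (X A) = ((√(w c.1) : ℝ) : ℂ) *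
        (a c + b c * bc (A c.1.1) + d c * bc (A c.1.2.1)) := by
      simp [f, X]; ring
    rw [h0, norm_mul, mul_pow, habd, Complex.norm_real, Real.norm_eq_abs, sq_abs,
      Real.sq_sqrt (hw c.1 c.2).le]
    split_ifs <;> simp
  let s' : V × V × Pred → ℝ := fun c => if h : c ∈ Cs then s ⟨c, h⟩ else 0
  have hs' : ∀ c : Cs, s' c.1 = s c := fun c => by simp [s']
  refine ⟨Cs.filter (fun c => s' c ≠ 0), fun c => s' c * w c, Finset.filter_subset _ _, ?_, ?_, ?_⟩
  · intro c hc
    rw [Finset.mem_filter] at hc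
    have h1 : 0 ≤ s' c := by
      have := hs' ⟨c, hc.1⟩
      simp only at this
      rw [this]; exact hs _
    exact mul_pos (lt_of_le_of_ne h1 (Ne.symm hc.2)) (hw c hc.1)
  · have h1 : (Cs.filter (fun c => s' c ≠ 0)).card ≤ S.card := by
      have : Cs.filter (fun c => s' c ≠ 0) ⊆ S.map (Function.Embedding.subtype _) := by
        intro c hc
        rw [Finset.mem_filter] at hc
        rw [Finset.mem_map]
        refine ⟨⟨c, hc.1⟩, ?_, rfl⟩
        by_contra hcS
        apply hc.2
        have h2 := hs' ⟨c, hc.1⟩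
        rw [hS _ hcS] at h2
        exact h2
      simpa using Finset.card_le_card this
    have h2 : ((Cs.filter (fun c => s' c ≠ 0)).card : ℝ) ≤ S.card := by exact_mod_cast h1
    refine h2.trans (hc.trans ?_)
    have h3 : (1 : ℝ) ≤ Fintype.card V := by exact_mod_cast Fintype.card_pos
    have h4 : 0 < ε := hε.1
    push_cast
    gcongr ?_ / _
    linarith
  · intro A
    have e1 : vcspVal Cs w A = ∑ c : Cs, ‖f c (X A)‖ ^ 2 := by
      simp only [hf]
      rw [vcspVal, ← Finset.sum_coe_sort]
    have e2 : vcspVal (Cs.filter (fun c => s' c ≠ 0)) (fun c => s' c * w c) A =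
        ∑ c : Cs, s c * ‖f c (X A)‖ ^ 2 := by
      simp only [hf, ← hs']
      rw [vcspVal, Finset.sum_filter,
        Finset.sum_coe_sort Cs
          (fun c => s' c * (if c.2.2 (A c.1) (A c.2.1) then w c else 0))]
      refine Finset.sum_congr rfl fun c _ => ?_
      by_cases h : s' c = 0
      · simp [h]
      · simp [h]
    rw [e1, e2]
    exact hx (X A)
end
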